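/- Let d be an integer with −3 ≤ d ≤ 3 and let n, m be natural numbers with n ≥ 3 and m ≥ 4. Then C(n,3) = C(m,4) + d holds if and only if (d, n, m) is one of the following triples: for d = 3: (4, 4); for d = 0: (3, 4), (7, 7); for d = −1: (4, 5), (34, 21); for d ∈ {2, 1, −2, −3}: no solutions. -/

import Mathlib

/-- The free `R`-algebra on `1, θ, θ², θ³` with `θ⁴ = c₀ + c₁ θ + c₂ θ² + c₃ θ³`. -/
@[ext]
structure QuarticRing (R : Type*) (c₀ c₁ c₂ c₃ : R) where
  x0 : R
  x1 : R
  x2 : R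
  x3 : R

namespace QuarticRing

section Ring

variable {R : Type*} [CommRing R] {c₀ c₁ c₂ c₃ : R}

instance : Zero (QuarticRing R c₀ c₁ c₂ c₃) := ⟨⟨0, 0, 0, 0⟩⟩
instance : One (QuarticRing R c₀ c₁ c₂ c₃) := ⟨⟨1, 0, 0, 0⟩⟩
instance : Add (QuarticRing R c₀ c₁ c₂ c₃) :=
  ⟨fun x y => ⟨x.x0 + y.x0, x.x1 + y.x1, x.x2 + y.x2, x.x3 + y.x3⟩⟩
instance : Neg (QuarticRing R c₀ c₁ c₂ c₃) := ⟨fun x => ⟨-x.x0, -x.x1, -x.x2, -x.x3⟩⟩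

/-- Coefficient of `θ⁶` in the unreduced product. -/
def high6 (x y : QuarticRing R c₀ c₁ c₂ c₃) : R := x.x3 * y.x3

/-- Coefficient of `θ⁵` in a product after eliminating `θ⁶`. -/
def high5 (x y : QuarticRing R c₀ c₁ c₂ c₃) : R :=
  x.x2 * y.x3 + x.x3 * y.x2 + c₃ * high6 x y

/-- Coefficient of `θ⁴` in a product after eliminating `θ⁵` and `θ⁶`. -/
def high4 (x y : QuarticRing R c₀ c₁ c₂ c₃) : R :=
  x.x1 * y.x3 + x.x2 * y.x2 + x.x3 * y.x1 + c₃ * high5 x y + c₂ * high6 x y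

instance : Mul (QuarticRing R c₀ c₁ c₂ c₃) :=
  ⟨fun x y => ⟨x.x0 * y.x0 + c₀ * high4 x y,
    x.x0 * y.x1 + x.x1 * y.x0 + c₁ * high4 x y + c₀ * high5 x y,
    x.x0 * y.x2 + x.x1 * y.x1 + x.x2 * y.x0 + c₂ * high4 x y + c₁ * high5 x y + c₀ * high6 x y,
    x.x0 * y.x3 + x.x1 * y.x2 + x.x2 * y.x1 + x.x3 * y.x0
      + c₃ * high4 x y + c₂ * high5 x y + c₁ * high6 x y⟩⟩

variable (x y : QuarticRing R c₀ c₁ c₂ c₃)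

@[simp] lemma zero_x0 : (0 : QuarticRing R c₀ c₁ c₂ c₃).x0 = 0 := rfl
@[simp] lemma zero_x1 : (0 : QuarticRing R c₀ c₁ c₂ c₃).x1 = 0 := rfl
@[simp] lemma zero_x2 : (0 : QuarticRing R c₀ c₁ c₂ c₃).x2 = 0 := rfl
@[simp] lemma zero_x3 : (0 : QuarticRing R c₀ c₁ c₂ c₃).x3 = 0 := rfl
@[simp] lemma one_x0 : (1 : QuarticRing R c₀ c₁ c₂ c₃).x0 = 1 := rfl
@[simp] lemma one_x1 : (1 : QuarticRing R c₀ c₁ c₂ c₃).x1 = 0 := rfl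
@[simp] lemma one_x2 : (1 : QuarticRing R c₀ c₁ c₂ c₃).x2 = 0 := rfl
@[simp] lemma one_x3 : (1 : QuarticRing R c₀ c₁ c₂ c₃).x3 = 0 := rfl
@[simp] lemma add_x0 : (x + y).x0 = x.x0 + y.x0 := rfl
@[simp] lemma add_x1 : (x + y).x1 = x.x1 + y.x1 := rfl
@[simp] lemma add_x2 : (x + y).x2 = x.x2 + y.x2 := rfl
@[simp] lemma add_x3 : (x + y).x3 = x.x3 + y.x3 := rfl
@[simp] lemma neg_x0 : (-x).x0 = -x.x0 := rfl
@[simp] lemma neg_x1 : (-x).x1 = -x.x1 := rfl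
@[simp] lemma neg_x2 : (-x).x2 = -x.x2 := rfl
@[simp] lemma neg_x3 : (-x).x3 = -x.x3 := rfl
lemma mul_x0 : (x * y).x0 = x.x0 * y.x0 + c₀ * high4 x y := rfl
lemma mul_x1 : (x * y).x1 =
    x.x0 * y.x1 + x.x1 * y.x0 + c₁ * high4 x y + c₀ * high5 x y := rfl
lemma mul_x2 : (x * y).x2 = x.x0 * y.x2 + x.x1 * y.x1 + x.x2 * y.x0
    + c₂ * high4 x y + c₁ * high5 x y + c₀ * high6 x y := rfl
lemma mul_x3 : (x * y).x3 = x.x0 * y.x3 + x.x1 * y.x2 + x.x2 * y.x1 + x.x3 * y.x0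
    + c₃ * high4 x y + c₂ * high5 x y + c₁ * high6 x y := rfl

instance : CommRing (QuarticRing R c₀ c₁ c₂ c₃) where
  add_assoc _ _ _ := by ext <;> simp [add_assoc]
  zero_add _ := by ext <;> simp
  add_zero _ := by ext <;> simp
  add_comm _ _ := by ext <;> simp [add_comm]
  neg_add_cancel _ := by ext <;> simp
  left_distrib _ _ _ := by
    ext <;> simp only [mul_x0, mul_x1, mul_x2, mul_x3, high4, high5, high6, add_x0, add_x1,
      add_x2, add_x3] <;> ring
  right_distrib _ _ _ := by
    ext <;> simp only [mul_x0, mul_x1, mul_x2, mul_x3, high4, high5, high6, add_x0, add_x1,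
      add_x2, add_x3] <;> ring
  zero_mul _ := by ext <;> simp [mul_x0, mul_x1, mul_x2, mul_x3, high4, high5, high6]
  mul_zero _ := by ext <;> simp [mul_x0, mul_x1, mul_x2, mul_x3, high4, high5, high6]
  mul_assoc _ _ _ := by
    ext <;> simp only [mul_x0, mul_x1, mul_x2, mul_x3, high4, high5, high6] <;> ring
  one_mul _ := by ext <;> simp [mul_x0, mul_x1, mul_x2, mul_x3, high4, high5, high6]
  mul_one _ := by ext <;> simp [mul_x0, mul_x1, mul_x2, mul_x3, high4, high5, high6]
  mul_comm _ _ := by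
    ext <;> simp only [mul_x0, mul_x1, mul_x2, mul_x3, high4, high5, high6] <;> ring
  nsmul := nsmulRec
  zsmul := zsmulRec

@[simp] lemma sub_x0 : (x - y).x0 = x.x0 - y.x0 := by simp [sub_eq_add_neg]
@[simp] lemma sub_x1 : (x - y).x1 = x.x1 - y.x1 := by simp [sub_eq_add_neg]
@[simp] lemma sub_x2 : (x - y).x2 = x.x2 - y.x2 := by simp [sub_eq_add_neg]
@[simp] lemma sub_x3 : (x - y).x3 = x.x3 - y.x3 := by simp [sub_eq_add_neg]

/-- The embedding of constants. -/
def const : R →+* QuarticRing R c₀ c₁ c₂ c₃ where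
  toFun a := ⟨a, 0, 0, 0⟩
  map_one' := rfl
  map_zero' := rfl
  map_add' _ _ := by ext <;> simp
  map_mul' _ _ := by ext <;> simp [mul_x0, mul_x1, mul_x2, mul_x3, high4, high5, high6]

lemma const_mul (a : R) : const a * x = ⟨a * x.x0, a * x.x1, a * x.x2, a * x.x3⟩ := by
  ext <;> simp [const, mul_x0, mul_x1, mul_x2, mul_x3, high4, high5, high6]

/-- Evaluation at a root of the defining quartic. -/
def evalHom {S : Type*} [CommRing S] (f : R →+* S) (t : S)
    (ht : t ^ 4 = f c₀ + f c₁ * t + f c₂ * t ^ 2 + f c₃ * t ^ 3) :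
    QuarticRing R c₀ c₁ c₂ c₃ →+* S where
  toFun x := f x.x0 + f x.x1 * t + f x.x2 * t ^ 2 + f x.x3 * t ^ 3
  map_one' := by simp
  map_zero' := by simp
  map_add' x y := by simp only [add_x0, add_x1, add_x2, add_x3, map_add]; ring
  map_mul' x y := by
    simp only [mul_x0, mul_x1, mul_x2, mul_x3, high4, high5, high6, map_add, map_mul]
    linear_combination -(f x.x3 * f y.x3 * t ^ 2
      + (f x.x2 * f y.x3 + f x.x3 * f y.x2 + f c₃ * (f x.x3 * f y.x3)) * t
      + (f x.x1 * f y.x3 + f x.x2 * f y.x2 + f x.x3 * f y.x1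
        + f c₃ * (f x.x2 * f y.x3 + f x.x3 * f y.x2 + f c₃ * (f x.x3 * f y.x3))
        + f c₂ * (f x.x3 * f y.x3))) * ht

/-- Coordinatewise change of coefficients. -/
def mapHom {S : Type*} [CommRing S] (f : R →+* S) {d₀ d₁ d₂ d₃ : S}
    (h₀ : f c₀ = d₀) (h₁ : f c₁ = d₁) (h₂ : f c₂ = d₂) (h₃ : f c₃ = d₃) :
    QuarticRing R c₀ c₁ c₂ c₃ →+* QuarticRing S d₀ d₁ d₂ d₃ where
  toFun x := ⟨f x.x0, f x.x1, f x.x2, f x.x3⟩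
  map_one' := by ext <;> simp
  map_zero' := by ext <;> simp
  map_add' x y := by ext <;> simp
  map_mul' x y := by
    subst h₀ h₁ h₂ h₃
    ext <;> simp [mul_x0, mul_x1, mul_x2, mul_x3, high4, high5, high6]

end Ring

end QuarticRing

/-- A domain in which any three units are multiplicatively dependent and the only units of finite
order are `±1`. -/
structure RankTwoUnits (A : Type*) [CommRing A] : Prop where
  isDomain : IsDomain A
  eq_one_or_neg_one : ∀ (u : Aˣ) (n : ℕ), n ≠ 0 → u ^ n = 1 → u = 1 ∨ u = -1
  dependent : ∀ u v w : Aˣ, ∃ k a b : ℤ, (k ≠ 0 ∨ a ≠ 0 ∨ b ≠ 0) ∧ u ^ k * v ^ a * w ^ b = 1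

lemma quartic_disc_eq (p q r s : ℝ) :
    let c₀ := -(p * q * r * s)
    let c₁ := p * q * r + p * q * s + p * r * s + q * r * s
    let c₂ := -(p * q + p * r + p * s + q * r + q * s + r * s)
    let c₃ := p + q + r + s
    4 * (-12 * c₀ - 3 * c₃ * c₁ + c₂ ^ 2) ^ 3 - (72 * c₂ * c₀ - 9 * c₃ * c₂ * c₁
      - 27 * c₁ ^ 2 + 27 * c₀ * c₃ ^ 2 + 2 * c₂ ^ 3) ^ 2
      = 27 * ((p - q) * (p - r) * (p - s) * (q - r) * (q - s) * (r - s)) ^ 2 := by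
  intro c₀ c₁ c₂ c₃
  simp only [c₀, c₁, c₂, c₃]
  ring

open Polynomial in
/-- A real quartic of negative discriminant has a nonreal root. -/
lemma exists_nonreal_root (c₀ c₁ c₂ c₃ : ℝ)
    (hdisc : 4 * (-12 * c₀ - 3 * c₃ * c₁ + c₂ ^ 2) ^ 3 < (72 * c₂ * c₀ - 9 * c₃ * c₂ * c₁
      - 27 * c₁ ^ 2 + 27 * c₀ * c₃ ^ 2 + 2 * c₂ ^ 3) ^ 2) :
    ∃ z : ℂ, z ^ 4 = c₀ + c₁ * z + c₂ * z ^ 2 + c₃ * z ^ 3 ∧ z.im ≠ 0 := by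
  by_contra! hreal
  set f : ℂ[X] := X ^ 4 - (C (c₃ : ℂ) * X ^ 3 + C (c₂ : ℂ) * X ^ 2 + C (c₁ : ℂ) * X + C (c₀ : ℂ))
    with hf
  have hdeg : f.natDegree = 4 := by rw [hf]; compute_degree!
  have hmon : f.Monic := by rw [hf]; monicity!
  have hsplit := IsAlgClosed.splits f
  have hcard : f.roots.card = 4 := by rw [← hdeg]; exact hsplit.natDegree_eq_card_roots.symm
  have hprod := hsplit.eq_prod_roots_of_monic hmon
  have hroot : ∀ z ∈ f.roots, z.im = 0 := fun z hz => by
    apply hreal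
    have h := (mem_roots'.1 hz).2
    simp only [hf, IsRoot.def, eval_sub, eval_pow, eval_X, eval_add, eval_mul, eval_C] at h
    linear_combination h
  obtain ⟨a, s, hs⟩ : ∃ a s, f.roots = a ::ₘ s := by
    obtain ⟨a, ha⟩ := Multiset.card_pos_iff_exists_mem.1 (hcard ▸ (by norm_num : 0 < 4))
    exact ⟨a, Multiset.exists_cons_of_mem ha⟩
  rw [hs, Multiset.card_cons] at hcard
  obtain ⟨b, c, d, rfl⟩ := Multiset.card_eq_three.1 (by omega : s.card = 3)
  rw [hs] at hprod hroot
  have real (z : ℂ) (hz : z.im = 0) : z = (z.re : ℂ) := by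
    apply Complex.ext <;> simp [hz]
  have ha := real a (hroot a (by simp))
  have hb := real b (hroot b (by simp))
  have hc := real c (hroot c (by simp))
  have hd := real d (hroot d (by simp))
  have key (t : ℝ) : t ^ 4 - (c₃ * t ^ 3 + c₂ * t ^ 2 + c₁ * t + c₀)
      = (t - a.re) * ((t - b.re) * ((t - c.re) * (t - d.re))) := by
    have h := congrArg (eval (t : ℂ)) hprod
    simp only [hf, Multiset.insert_eq_cons, Multiset.map_cons, Multiset.map_singleton,
      Multiset.prod_cons, Multiset.prod_singleton, eval_sub, eval_pow, eval_X, eval_add,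
      eval_mul, eval_C] at h
    rw [ha, hb, hc, hd] at h
    exact_mod_cast h
  generalize a.re = p, b.re = q, c.re = r, d.re = s at key
  have k0 := key 0
  have k1 := key 1
  have k2 := key (-1)
  have k3 := key 2
  have e0 : c₀ = -(p * q * r * s) := by linear_combination -k0
  have e3 : c₃ = p + q + r + s := by
    linear_combination -k3 / 6 + k1 / 2 - k0 / 2 + k2 / 6
  have e2 : c₂ = -(p * q + p * r + p * s + q * r + q * s + r * s) := by
    linear_combination -k1 / 2 - k2 / 2 + k0
  have e1 : c₁ = p * q * r + p * q * s + p * r * s + q * r * s := by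
    linear_combination -k1 - e0 - e2 - e3
  have h := quartic_disc_eq p q r s
  simp only [← e0, ← e1, ← e2, ← e3] at h
  linarith [sq_nonneg ((p - q) * (p - r) * (p - s) * (q - r) * (q - s) * (r - s))]

namespace NumberField

open InfinitePlace Module

lemma units_rank_le_two {K : Type*} [Field K] [NumberField K] (h4 : finrank ℚ K = 4)
    (φ : K →+* ℂ) (θ : K) (hθ : (φ θ).im ≠ 0) : Units.rank K ≤ 2 := by
  have hc : 0 < nrComplexPlaces K := by
    classical
    rw [nrComplexPlaces, Fintype.card_pos_iff]
    refine ⟨⟨InfinitePlace.mk φ, isComplex_mk_iff.2 fun hr => hθ ?_⟩⟩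
    have := congrFun (congrArg DFunLike.coe hr) θ
    rw [ComplexEmbedding.conjugate_coe_eq] at this
    exact Complex.conj_eq_iff_im.1 this
  have h1 := card_add_two_mul_card_eq_rank K
  have h2 := card_eq_nrRealPlaces_add_nrComplexPlaces K
  rw [Units.rank]
  omega

lemma units_dependent {K : Type*} [Field K] [NumberField K] (h : Units.rank K ≤ 2)
    (u v w : (𝓞 K)ˣ) :
    ∃ k a b : ℤ, (k ≠ 0 ∨ a ≠ 0 ∨ b ≠ 0) ∧ u ^ k * v ^ a * w ^ b = 1 := by
  have hli : ¬ LinearIndependent ℤ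
      ![Additive.ofMul u, Additive.ofMul v, Additive.ofMul w] := fun hli => by
    have := hli.fintype_card_le_finrank
    rw [Units.finrank_eq, Fintype.card_fin] at this
    omega
  obtain ⟨g, hg, i, hi⟩ := Fintype.not_linearIndependent_iff.1 hli
  refine ⟨g 0, g 1, g 2, ?_, ?_⟩
  · fin_cases i <;> simp_all
  · rw [Fin.sum_univ_three] at hg
    exact hg

end NumberField

namespace QuarticRing

open Polynomial

variable (c₀ c₁ c₂ c₃ : ℤ)

/-- The defining polynomial of the quartic ring. -/
noncomputable def poly (R : Type*) [CommRing R] : R[X] :=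
  X ^ 4 - (C (c₃ : R) * X ^ 3 + C (c₂ : R) * X ^ 2 + C (c₁ : R) * X + C (c₀ : R))

lemma poly_monic (R : Type*) [CommRing R] [Nontrivial R] : (poly c₀ c₁ c₂ c₃ R).Monic := by
  rw [poly]; monicity!

lemma poly_natDegree (R : Type*) [CommRing R] [Nontrivial R] :
    (poly c₀ c₁ c₂ c₃ R).natDegree = 4 := by
  rw [poly]; compute_degree!

lemma eval₂_poly {R S : Type*} [CommRing R] [CommRing S] (f : R →+* S) (t : S) :
    eval₂ f t (poly c₀ c₁ c₂ c₃ R) = t ^ 4 - (c₃ * t ^ 3 + c₂ * t ^ 2 + c₁ * t + c₀) := by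
  simp only [poly, eval₂_sub, eval₂_pow, eval₂_add, eval₂_mul, eval₂_C, eval₂_X]
  simp only [map_intCast]

lemma irreducible_poly {p : ℕ} (hprime : p.Prime)
    (h1 : ∀ t : ZMod p, t ^ 4 ≠ c₃ * t ^ 3 + c₂ * t ^ 2 + c₁ * t + c₀)
    (h2 : ∀ a b : ZMod p,
      ¬ (a * (-c₂ - b + a * (c₃ + a)) - b * (c₃ + a) = -c₁ ∧ b * (-c₂ - b + a * (c₃ + a)) = -c₀)) :
    Irreducible (poly c₀ c₁ c₂ c₃ ℚ) := by
  have := Fact.mk hprime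
  have hp : Irreducible (poly c₀ c₁ c₂ c₃ (ZMod p)) := by
    have hm := poly_monic c₀ c₁ c₂ c₃ (ZMod p)
    have hd := poly_natDegree c₀ c₁ c₂ c₃ (ZMod p)
    rw [hm.irreducible_iff_lt_natDegree_lt (fun h => by simp [h] at hd)]
    intro q hq hdeg ⟨g, hg⟩
    have hgm : g.Monic := hq.of_mul_monic_left (hg ▸ hm)
    have hdg : 4 = q.natDegree + g.natDegree := by rw [← hd, hg, hq.natDegree_mul hgm]
    rw [hd, Finset.mem_Ioc] at hdeg
    have ev (t : ZMod p) : t ^ 4 - (c₃ * t ^ 3 + c₂ * t ^ 2 + c₁ * t + c₀)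
        = q.eval t * g.eval t := by
      rw [← eval_mul, ← hg, ← eval₂_poly c₀ c₁ c₂ c₃ (RingHom.id _) t]; rfl
    obtain hq1 | hq2 : q.natDegree = 1 ∨ q.natDegree = 2 := by omega
    · rw [hq.eq_X_add_C hq1] at ev
      refine h1 (-q.coeff 0) ?_
      have := ev (-q.coeff 0)
      simp only [eval_add, eval_X, eval_C, neg_add_cancel, zero_mul] at this
      linear_combination this
    · have hg2 : g.natDegree = 2 := by omega
      have quad (h : (ZMod p)[X]) (hh : h.Monic) (h2 : h.natDegree = 2) :
          h = X ^ 2 + C (h.coeff 1) * X + C (h.coeff 0) := by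
        conv_lhs => rw [hh.as_sum, h2]
        simp [Finset.sum_range_succ]
        ring
      rw [quad q hq hq2, quad g hgm hg2] at hg
      generalize q.coeff 1 = a, q.coeff 0 = b, g.coeff 1 = c, g.coeff 0 = d at hg
      have e : (X ^ 2 + C a * X + C b) * (X ^ 2 + C c * X + C d)
          = X ^ 4 + (C (a + c) * X ^ 3 + C (b + d + a * c) * X ^ 2 + C (a * d + b * c) * X
            + C (b * d)) := by
        simp only [C_add, C_mul]; ring
      rw [e, poly] at hg
      have k0 := congrArg (coeff · 0) hg
      have k1 := congrArg (coeff · 1) hg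
      have k2 := congrArg (coeff · 2) hg
      have k3 := congrArg (coeff · 3) hg
      simp [coeff_X_pow, coeff_C, -map_intCast, -map_add, -map_mul] at k0 k1 k2 k3
      have hc : c = -(c₃ + a) := by linear_combination -k3
      have hd' : d = -c₂ - b + a * (c₃ + a) := by
        subst hc
        linear_combination -k2
      refine h2 a b ⟨?_, ?_⟩
      · rw [← hd']; subst hc; linear_combination -k1
      · rw [← hd']; linear_combination -k0
  have hZ : Irreducible (poly c₀ c₁ c₂ c₃ ℤ) := by
    refine (poly_monic c₀ c₁ c₂ c₃ ℤ).irreducible_of_irreducible_map (Int.castRingHom (ZMod p)) _ ?_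
    convert hp using 1
    simp [poly]
  have := ((poly_monic c₀ c₁ c₂ c₃ ℤ).irreducible_iff_irreducible_map_fraction_map (K := ℚ)).1 hZ
  convert this using 1
  simp [poly]

variable {c₀ c₁ c₂ c₃}

/-- Dirichlet's unit theorem for the order `ℤ[θ]` of a quartic field of mixed signature. -/
theorem rankTwoUnits (hirr : Irreducible (poly c₀ c₁ c₂ c₃ ℚ))
    (hdisc : 4 * (-12 * c₀ - 3 * c₃ * c₁ + c₂ ^ 2) ^ 3 < (72 * c₂ * c₀ - 9 * c₃ * c₂ * c₁
      - 27 * c₁ ^ 2 + 27 * c₀ * c₃ ^ 2 + 2 * c₂ ^ 3) ^ 2)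
    (s : ℤ) (hs : s ^ 4 < c₃ * s ^ 3 + c₂ * s ^ 2 + c₁ * s + c₀) :
    RankTwoUnits (QuarticRing ℤ c₀ c₁ c₂ c₃) := by
  have : Fact (Irreducible (poly c₀ c₁ c₂ c₃ ℚ)) := ⟨hirr⟩
  let K := AdjoinRoot (poly c₀ c₁ c₂ c₃ ℚ)
  have hne : poly c₀ c₁ c₂ c₃ ℚ ≠ 0 := hirr.ne_zero
  let pb : PowerBasis ℚ K := AdjoinRoot.powerBasis hne
  have hdim : pb.dim = 4 := by
    rw [AdjoinRoot.powerBasis_dim, poly_natDegree]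
  have : FiniteDimensional ℚ K := pb.finite
  have : CharZero K := algebraRat.charZero K
  have : NumberField K := ⟨⟩
  have hfin : Module.finrank ℚ K = 4 := by rw [pb.finrank, hdim]
  let θ : K := AdjoinRoot.root (poly c₀ c₁ c₂ c₃ ℚ)
  have hθ : θ ^ 4 = (c₀ : K) + c₁ * θ + c₂ * θ ^ 2 + c₃ * θ ^ 3 := by
    have := AdjoinRoot.eval₂_root (poly c₀ c₁ c₂ c₃ ℚ)
    rw [eval₂_poly] at this
    linear_combination this
  let φ : QuarticRing ℤ c₀ c₁ c₂ c₃ →+* K := evalHom (Int.castRingHom K) θ (by simpa using hθ)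
  have hφ : Function.Injective φ := by
    rw [injective_iff_map_eq_zero]
    intro x hx
    have hx' : (x.x0 : K) + x.x1 * θ + x.x2 * θ ^ 2 + x.x3 * θ ^ 3 = 0 := by
      simpa [φ, evalHom] using hx
    have hli := pb.basis.linearIndependent
    rw [Fintype.linearIndependent_iff] at hli
    have key := hli (fun i => ![(x.x0 : ℚ), x.x1, x.x2, x.x3] (Fin.cast hdim i)) (by
      have : ∀ i, pb.basis i = θ ^ (i : ℕ) := fun i => by
        rw [pb.basis_eq_pow]; simp [pb, θ]
      simp only [this]
      rw [← Equiv.sum_comp (finCongr hdim.symm)]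
      simp [Fin.sum_univ_four, Algebra.smul_def]
      linear_combination hx')
    have k (i : Fin 4) := key (finCongr hdim.symm i)
    ext
    · simpa using k 0
    · simpa using k 1
    · simpa using k 2
    · simpa using k 3
  constructor
  · exact hφ.isDomain φ
  · intro u n hn hu
    obtain ⟨t, ht⟩ : ∃ t : ℝ, t ^ 4 - (c₃ * t ^ 3 + c₂ * t ^ 2 + c₁ * t + c₀) = 0 := by
      set M : ℝ := 1 + |(c₀ : ℝ)| + |(c₁ : ℝ)| + |(c₂ : ℝ)| + |(c₃ : ℝ)| with hM
      set B : ℝ := max M s with hB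
      have hBM : M ≤ B := le_max_left _ _
      have h0 := abs_nonneg (c₀ : ℝ)
      have h1 := abs_nonneg (c₁ : ℝ)
      have h2 := abs_nonneg (c₂ : ℝ)
      have h3 := abs_nonneg (c₃ : ℝ)
      have hB1 : 1 ≤ B := by linarith
      have p2 : B ^ 2 ≤ B ^ 3 := pow_le_pow_right₀ hB1 (by norm_num)
      have p1 : B ≤ B ^ 3 := le_self_pow₀ hB1 (by norm_num)
      have p0 : 1 ≤ B ^ 3 := one_le_pow₀ hB1
      have hpos : 0 ≤ B ^ 4 - (c₃ * B ^ 3 + c₂ * B ^ 2 + c₁ * B + c₀) := by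
        have q3 : c₃ * B ^ 3 ≤ |(c₃ : ℝ)| * B ^ 3 := by gcongr; exact le_abs_self _
        have q2 : c₂ * B ^ 2 ≤ |(c₂ : ℝ)| * B ^ 3 := by
          gcongr; exact le_abs_self _
        have q1 : c₁ * B ≤ |(c₁ : ℝ)| * B ^ 3 := by
          gcongr; exact le_abs_self _
        have q0 : (c₀ : ℝ) ≤ |(c₀ : ℝ)| * B ^ 3 := by
          nlinarith [le_abs_self (c₀ : ℝ)]
        have : M * B ^ 3 ≤ B ^ 4 := by
          rw [pow_succ' B 3]; gcongr
        rw [hM] at this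
        nlinarith
      have hneg : (s : ℝ) ^ 4 - (c₃ * s ^ 3 + c₂ * s ^ 2 + c₁ * s + c₀) ≤ 0 := by
        have : (s : ℝ) ^ 4 < c₃ * s ^ 3 + c₂ * s ^ 2 + c₁ * s + c₀ := by exact_mod_cast hs
        linarith
      have hcont : ContinuousOn (fun t : ℝ => t ^ 4 - (c₃ * t ^ 3 + c₂ * t ^ 2 + c₁ * t + c₀))
          (Set.Icc (s : ℝ) B) := by fun_prop
      obtain ⟨t, -, ht⟩ := intermediate_value_Icc (le_max_right _ _) hcont ⟨hneg, hpos⟩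
      exact ⟨t, ht⟩
    let σ : K →+* ℝ := AdjoinRoot.lift (algebraMap ℚ ℝ) t (by rw [eval₂_poly]; exact ht)
    have hσ : Function.Injective (σ.comp φ) := σ.injective.comp hφ
    have h1 : (σ.comp φ u) ^ n = 1 := by
      rw [← map_pow, ← Units.val_pow_eq_pow_val, hu, Units.val_one, map_one]
    have h2 : |σ.comp φ u| = 1 := by
      rw [← pow_eq_one_iff_of_nonneg (abs_nonneg _) hn, ← abs_pow, h1, abs_one]
    rcases (abs_eq (by norm_num)).1 h2 with h | h
    · left
      ext1
      exact hσ (by rw [h, Units.val_one, map_one])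
    · right
      ext1
      exact hσ (by rw [h, Units.val_neg, Units.val_one, map_neg, map_one])
  · intro u v w
    obtain ⟨z, hz, him⟩ := exists_nonreal_root (c₀ : ℝ) c₁ c₂ c₃ (by exact_mod_cast hdisc)
    let σ : K →+* ℂ := AdjoinRoot.lift (algebraMap ℚ ℂ) z (by
      rw [eval₂_poly, hz]; push_cast; ring)
    have hrank := NumberField.units_rank_le_two hfin σ θ (by
      rw [show σ θ = z from AdjoinRoot.lift_root _]; exact him)
    have hθi : IsIntegral ℤ θ := by
      refine ⟨poly c₀ c₁ c₂ c₃ ℤ, poly_monic c₀ c₁ c₂ c₃ ℤ, ?_⟩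
      rw [eval₂_poly, hθ]
      ring
    have hI (m : ℤ) : IsIntegral ℤ (m : K) := by
      simpa using (isIntegral_algebraMap : IsIntegral ℤ (algebraMap ℤ K m))
    let ψ : QuarticRing ℤ c₀ c₁ c₂ c₃ →* NumberField.RingOfIntegers K :=
      NumberField.RingOfIntegers.restrict_monoidHom (φ : _ →* K) fun x => by
        change IsIntegral ℤ ((x.x0 : K) + x.x1 * θ + x.x2 * θ ^ 2 + x.x3 * θ ^ 3)
        exact (((hI _).add ((hI _).mul hθi)).add ((hI _).mul (hθi.pow 2))).add
          ((hI _).mul (hθi.pow 3))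
    have hψ : Function.Injective ψ := fun x y h => hφ (congrArg (algebraMap _ K) h)
    obtain ⟨k, a, b, h0, h⟩ := NumberField.units_dependent hrank
      (Units.map ψ u) (Units.map ψ v) (Units.map ψ w)
    refine ⟨k, a, b, h0, Units.map_injective hψ ?_⟩
    rw [map_one, ← h, map_mul, map_mul, map_zpow, map_zpow, map_zpow]

end QuarticRing

section Skolem

variable {A : Type*} [CommRing A]

lemma exists_one_add_pow_eq (z : A) (n : ℕ) :
    ∃ r, (1 + z) ^ n = 1 + n * z + n.choose 2 * z ^ 2 + z ^ 3 * r := by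
  induction n with
  | zero => exact ⟨0, by simp⟩
  | succ n ih =>
    obtain ⟨r, hr⟩ := ih
    refine ⟨n.choose 2 + (1 + z) * r, ?_⟩
    rw [pow_succ, hr, Nat.choose_succ_succ' n 1, Nat.choose_one_right]
    push_cast
    ring

lemma pow_prime_congr {l : ℕ} (hl : Odd l) {s : ℕ} {g z : A}
    (h : (l : A) ^ (s + 2) ∣ g - (1 + (l : A) ^ (s + 1) * z)) :
    (l : A) ^ (s + 3) ∣ g ^ l - (1 + (l : A) ^ (s + 2) * z) := by
  obtain ⟨w, hw⟩ := h
  obtain ⟨k, hk⟩ := hl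
  have hg : g = 1 + (l : A) ^ (s + 1) * (z + l * w) := by linear_combination hw
  obtain ⟨r, hr⟩ := exists_one_add_pow_eq ((l : A) ^ (s + 1) * (z + l * w)) l
  have hc : ((l.choose 2 : ℕ) : A) = l * k := by
    have : l.choose 2 = l * k := by
      rw [Nat.choose_two_right, hk, Nat.add_sub_cancel, mul_left_comm,
        Nat.mul_div_cancel_left _ two_pos]
    rw [this]; push_cast; rfl
  refine ⟨w + (l : A) ^ s * k * (z + l * w) ^ 2 + (l : A) ^ (2 * s) * (z + l * w) ^ 3 * r, ?_⟩
  rw [hg, hr, hc]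
  ring

lemma pow_prime_pow_congr {l : ℕ} (hl : Odd l) {g z : A}
    (h : (l : A) ^ 2 ∣ g - (1 + l * z)) (s : ℕ) :
    (l : A) ^ (s + 2) ∣ g ^ l ^ s - (1 + (l : A) ^ (s + 1) * z) := by
  induction s with
  | zero => simpa using h
  | succ s ih => rw [pow_succ l s, pow_mul]; exact pow_prime_congr hl ih

lemma zpow_congr {p z : A} {s : ℕ} {h : Aˣ}
    (hh : p ^ (s + 2) ∣ (h : A) - (1 + p ^ (s + 1) * z)) (x : ℤ) :
    p ^ (s + 2) ∣ ((h ^ x : Aˣ) : A) - (1 + p ^ (s + 1) * (x * z)) := by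
  obtain ⟨w, hw⟩ := hh
  have hw' : (h : A) = 1 + p ^ (s + 1) * z + p ^ (s + 2) * w := by linear_combination hw
  induction x with
  | zero => simp
  | succ i ih =>
    obtain ⟨t, ht⟩ := ih
    have ht' : ((h ^ (i : ℤ) : Aˣ) : A) = 1 + p ^ (s + 1) * (i * z) + p ^ (s + 2) * t := by
      push_cast at ht; linear_combination ht
    rw [zpow_add_one, Units.val_mul, ht', hw']
    push_cast
    exact ⟨w + t * (1 + p ^ (s + 1) * z + p ^ (s + 2) * w) + p ^ (s + 1) * i * z * w
      + p ^ s * i * z ^ 2, by ring⟩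
  | pred i ih =>
    obtain ⟨t, ht⟩ := ih
    set y : Aˣ := h ^ (-(i : ℤ) - 1) with hy
    have hyh : (y : A) * h = ((h ^ (-(i : ℤ)) : Aˣ) : A) := by
      rw [← Units.val_mul, hy, ← zpow_add_one, sub_add_cancel]
    have hinv : ((h⁻¹ : Aˣ) : A) * h = 1 := by simp
    have hyt : (y : A) * h - 1 + p ^ (s + 1) * (i * z) = p ^ (s + 2) * t := by
      rw [hyh]; push_cast at ht; linear_combination ht
    have hd : p ^ (s + 2) ∣ (y : A) * h - (1 - p ^ (s + 1) * ((i + 1) * z)) * h := by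
      refine ⟨t - w + p ^ s * ((i + 1) * z) * (z + p * w), ?_⟩
      rw [hw'] at hyt ⊢
      linear_combination hyt
    have := hd.mul_left ((h⁻¹ : Aˣ) : A)
    push_cast
    convert this using 1
    linear_combination (-(y : A) + (1 - p ^ (s + 1) * ((i + 1) * z))) * hinv

/-- Units congruent to one raised to multiples of `l ^ s`. -/
lemma zpow_mul_congr {l : ℕ} (hl : Odd l) {g : Aˣ} {z : A}
    (h : (l : A) ^ 2 ∣ (g : A) - (1 + l * z)) (s : ℕ) (x : ℤ) :
    (l : A) ^ (s + 2) ∣ ((g ^ ((l : ℤ) ^ s * x) : Aˣ) : A) - (1 + (l : A) ^ (s + 1) * (x * z)) := by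
  have h1 := pow_prime_pow_congr hl h s
  rw [← Units.val_pow_eq_pow_val] at h1
  have h2 := zpow_congr h1 x
  rw [zpow_mul]
  exact_mod_cast h2

lemma RankTwoUnits.exists_relation (hA : RankTwoUnits A) (u v w : Aˣ) :
    ∃ k a b : ℤ, (u ^ k * v ^ a * w ^ b = 1 ∨ u ^ k * v ^ a * w ^ b = -1) ∧
      ∀ r : ℕ, r.Prime → (r : ℤ) ∣ k → (r : ℤ) ∣ a → (r : ℤ) ∣ b → False := by
  obtain ⟨k, a, b, h0, h⟩ := hA.dependent u v w
  set g : ℕ := Int.gcd k (Int.gcd a b) with hg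
  have hgk : (g : ℤ) ∣ k := Int.gcd_dvd_left _ _
  have hgab : (g : ℤ) ∣ (Int.gcd a b : ℤ) := Int.gcd_dvd_right _ _
  obtain ⟨k', hk⟩ := hgk
  obtain ⟨a', ha⟩ := hgab.trans (Int.gcd_dvd_left _ _)
  obtain ⟨b', hb⟩ := hgab.trans (Int.gcd_dvd_right _ _)
  have hg0 : g ≠ 0 := by
    rintro h'
    rw [h'] at hk ha hb
    simp at hk ha hb
    simp_all
  refine ⟨k', a', b', hA.eq_one_or_neg_one _ g hg0 ?_, ?_⟩
  · rw [← h, hk, ha, hb, mul_pow, mul_pow]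
    simp only [← zpow_natCast, ← zpow_mul, mul_comm]
  · rintro r hr ⟨k'', rfl⟩ ⟨a'', rfl⟩ ⟨b'', rfl⟩
    have h1 : ((g * r : ℕ) : ℤ) ∣ g := by
      push_cast
      refine Int.dvd_coe_gcd ?_ (Int.dvd_coe_gcd ?_ ?_)
      · exact ⟨k'', by rw [hk]; ring⟩
      · exact ⟨a'', by rw [ha]; ring⟩
      · exact ⟨b'', by rw [hb]; ring⟩
    have h2 := Nat.le_of_dvd (Nat.pos_of_ne_zero hg0) (Int.natCast_dvd_natCast.1 h1)
    have h3 := hr.two_le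
    nlinarith [Nat.pos_of_ne_zero hg0]

end Skolem

namespace QuarticRing

variable {c₀ c₁ c₂ c₃ : ℤ}

lemma intCast_mul (n : ℤ) (x : QuarticRing ℤ c₀ c₁ c₂ c₃) :
    (n : QuarticRing ℤ c₀ c₁ c₂ c₃) * x = ⟨n * x.x0, n * x.x1, n * x.x2, n * x.x3⟩ := by
  have : (n : QuarticRing ℤ c₀ c₁ c₂ c₃) = const n := by
    rw [← map_intCast (const (c₀ := c₀) (c₁ := c₁) (c₂ := c₂) (c₃ := c₃)) n, Int.cast_id]
  rw [this, const_mul]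

lemma intCast_dvd_iff (n : ℤ) (x : QuarticRing ℤ c₀ c₁ c₂ c₃) :
    (n : QuarticRing ℤ c₀ c₁ c₂ c₃) ∣ x ↔ n ∣ x.x0 ∧ n ∣ x.x1 ∧ n ∣ x.x2 ∧ n ∣ x.x3 := by
  constructor
  · rintro ⟨y, rfl⟩
    rw [intCast_mul]
    exact ⟨dvd_mul_right _ _, dvd_mul_right _ _, dvd_mul_right _ _, dvd_mul_right _ _⟩
  · rintro ⟨⟨a, ha⟩, ⟨b, hb⟩, ⟨c, hc⟩, ⟨d, hd⟩⟩
    exact ⟨⟨a, b, c, d⟩, by rw [intCast_mul]; ext <;> assumption⟩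

lemma intCast_mul_cancel {n : ℤ} (hn : n ≠ 0) {x y : QuarticRing ℤ c₀ c₁ c₂ c₃}
    (h : (n : QuarticRing ℤ c₀ c₁ c₂ c₃) * x = n * y) : x = y := by
  rw [intCast_mul, intCast_mul] at h
  injection h with h0 h1 h2 h3
  ext
  · exact mul_left_cancel₀ hn h0
  · exact mul_left_cancel₀ hn h1
  · exact mul_left_cancel₀ hn h2
  · exact mul_left_cancel₀ hn h3

lemma eq_zero_of_forall_pow_dvd {l : ℕ} (hl : 1 < l) {x : QuarticRing ℤ c₀ c₁ c₂ c₃}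
    (h : ∀ s : ℕ, (((l : ℤ) ^ s : ℤ) : QuarticRing ℤ c₀ c₁ c₂ c₃) ∣ x) : x = 0 := by
  have key (c : ℤ) (hc : ∀ s : ℕ, (l : ℤ) ^ s ∣ c) : c = 0 := by
    refine Int.eq_zero_of_abs_lt_dvd (hc c.natAbs) ?_
    rw [Int.abs_eq_natAbs]
    exact_mod_cast Nat.lt_pow_self hl
  simp only [intCast_dvd_iff] at h
  ext
  · exact key _ fun s => (h s).1
  · exact key _ fun s => (h s).2.1
  · exact key _ fun s => (h s).2.2.1
  · exact key _ fun s => (h s).2.2.2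

/-- One step of Skolem's `l`-adic argument. -/
lemma skolem_step {l : ℕ} (hp : l.Prime) (hl : Odd l)
    {v η₁ η₂ : (QuarticRing ℤ c₀ c₁ c₂ c₃)ˣ} {z₁ z₂ u₀ w : QuarticRing ℤ c₀ c₁ c₂ c₃}
    (h₁ : (l : QuarticRing ℤ c₀ c₁ c₂ c₃) ^ 2 ∣ η₁ - (1 + l * z₁))
    (h₂ : (l : QuarticRing ℤ c₀ c₁ c₂ c₃) ^ 2 ∣ η₂ - (1 + l * z₂))
    (hx2 : (v * u₀).x2 = u₀.x2) (hx3 : (v * u₀).x3 = u₀.x3)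
    (hdet : ¬ (l : ℤ) ∣ (z₁ * u₀).x2 * (z₂ * u₀).x3 - (z₁ * u₀).x3 * (z₂ * u₀).x2)
    {m x y : ℤ} {s : ℕ} (hw : (v : QuarticRing ℤ c₀ c₁ c₂ c₃) = 1 + l ^ (s + 1) * w)
    (hrel : v ^ m * η₁ ^ ((l : ℤ) ^ s * x) * η₂ ^ ((l : ℤ) ^ s * y) = 1) :
    (l : ℤ) ∣ x ∧ (l : ℤ) ∣ y ∧ ((l : ℤ) : QuarticRing ℤ c₀ c₁ c₂ c₃) ∣ (m : ℤ) * w := by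
  have hl0 : (l : ℤ) ≠ 0 := by exact_mod_cast hp.ne_zero
  have hc (i : ℕ) : (l : QuarticRing ℤ c₀ c₁ c₂ c₃) ^ i = (((l : ℤ) ^ i : ℤ) : _) := by
    push_cast; rfl
  obtain ⟨a, ha⟩ := zpow_mul_congr hl h₁ s x
  obtain ⟨b, hb⟩ := zpow_mul_congr hl h₂ s y
  obtain ⟨c, hcc⟩ := zpow_congr (p := (l : QuarticRing ℤ c₀ c₁ c₂ c₃)) (z := w) (s := s)
    (h := v) (by rw [hw]; simp) m
  have hrel' := congrArg Units.val hrel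
  rw [Units.val_mul, Units.val_mul, sub_eq_iff_eq_add.1 ha, sub_eq_iff_eq_add.1 hb,
    sub_eq_iff_eq_add.1 hcc, Units.val_one] at hrel'
  obtain ⟨t, ht⟩ : ∃ t, (m * w + x * z₁ + y * z₂ : QuarticRing ℤ c₀ c₁ c₂ c₃) = l * t := by
    set p := (l : QuarticRing ℤ c₀ c₁ c₂ c₃)
    set X := (x : QuarticRing ℤ c₀ c₁ c₂ c₃) * z₁
    set Y := (y : QuarticRing ℤ c₀ c₁ c₂ c₃) * z₂
    set W := (m : QuarticRing ℤ c₀ c₁ c₂ c₃) * w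
    refine ⟨-(a + b + c + p ^ s * ((W + p * c) * (X + p * a) + (W + p * c) * (Y + p * b)
      + (X + p * a) * (Y + p * b)) + p ^ (2 * s + 1) * ((W + p * c) * (X + p * a) * (Y + p * b))),
      ?_⟩
    refine intCast_mul_cancel (n := (l : ℤ) ^ (s + 1)) (pow_ne_zero _ hl0) ?_
    rw [← hc]
    linear_combination hrel'
  have hwu : v * u₀ = u₀ + l ^ (s + 1) * (w * u₀) := by rw [hw]; ring
  rw [hc, intCast_mul] at hwu
  have hw2 : (w * u₀).x2 = 0 := by
    have := congrArg x2 hwu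
    rw [hx2, add_x2] at this
    exact (mul_eq_zero.1 (by linarith : (l : ℤ) ^ (s + 1) * (w * u₀).x2 = 0)).resolve_left
      (pow_ne_zero _ hl0)
  have hw3 : (w * u₀).x3 = 0 := by
    have := congrArg x3 hwu
    rw [hx3, add_x3] at this
    exact (mul_eq_zero.1 (by linarith : (l : ℤ) ^ (s + 1) * (w * u₀).x3 = 0)).resolve_left
      (pow_ne_zero _ hl0)
  have hu : (m : QuarticRing ℤ c₀ c₁ c₂ c₃) * (w * u₀) + (x : ℤ) * (z₁ * u₀) + (y : ℤ) * (z₂ * u₀)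
      = ((l : ℤ) : QuarticRing ℤ c₀ c₁ c₂ c₃) * (t * u₀) := by
    push_cast; linear_combination u₀ * ht
  simp only [intCast_mul] at hu
  have e2 := congrArg x2 hu
  have e3 := congrArg x3 hu
  simp only [add_x2, add_x3, hw2, hw3, mul_zero, zero_add] at e2 e3
  have hpz : Prime (l : ℤ) := Nat.prime_iff_prime_int.1 hp
  have hx : (l : ℤ) ∣ x := by
    refine (hpz.dvd_or_dvd (a := x) ?_).resolve_right hdet
    exact ⟨(t * u₀).x2 * (z₂ * u₀).x3 - (t * u₀).x3 * (z₂ * u₀).x2, by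
      linear_combination (z₂ * u₀).x3 * e2 - (z₂ * u₀).x2 * e3⟩
  have hy : (l : ℤ) ∣ y := by
    refine (hpz.dvd_or_dvd (a := y) ?_).resolve_right hdet
    exact ⟨(t * u₀).x3 * (z₁ * u₀).x2 - (t * u₀).x2 * (z₁ * u₀).x3, by
      linear_combination (z₁ * u₀).x2 * e3 - (z₁ * u₀).x3 * e2⟩
  refine ⟨hx, hy, ?_⟩
  obtain ⟨x', rfl⟩ := hx
  obtain ⟨y', rfl⟩ := hy
  exact ⟨t - x' * z₁ - y' * z₂, by push_cast at ht ⊢; linear_combination ht⟩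

/-- Skolem's method: a unit congruent to one whose `θ²` and `θ³` coordinates satisfy two
independent linear conditions is trivial. -/
theorem skolem (hU : RankTwoUnits (QuarticRing ℤ c₀ c₁ c₂ c₃)) {l : ℕ} (hp : l.Prime) (hl : Odd l)
    {v η₁ η₂ : (QuarticRing ℤ c₀ c₁ c₂ c₃)ˣ} {z₁ z₂ u₀ : QuarticRing ℤ c₀ c₁ c₂ c₃}
    (hv : (l : QuarticRing ℤ c₀ c₁ c₂ c₃) ∣ v - 1)
    (h₁ : (l : QuarticRing ℤ c₀ c₁ c₂ c₃) ^ 2 ∣ η₁ - (1 + l * z₁))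
    (h₂ : (l : QuarticRing ℤ c₀ c₁ c₂ c₃) ^ 2 ∣ η₂ - (1 + l * z₂))
    (hx2 : (v * u₀).x2 = u₀.x2) (hx3 : (v * u₀).x3 = u₀.x3)
    (hdet : ¬ (l : ℤ) ∣ (z₁ * u₀).x2 * (z₂ * u₀).x3 - (z₁ * u₀).x3 * (z₂ * u₀).x2) :
    v = 1 := by
  obtain ⟨m, x, y, hsign, hgcd⟩ := hU.exists_relation v η₁ η₂
  have hrel : v ^ m * η₁ ^ x * η₂ ^ y = 1 := by
    refine hsign.resolve_right fun hneg => ?_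
    let q := Ideal.Quotient.mk (Ideal.span {(l : QuarticRing ℤ c₀ c₁ c₂ c₃)})
    have hq (g : QuarticRing ℤ c₀ c₁ c₂ c₃) (h : (l : QuarticRing ℤ c₀ c₁ c₂ c₃) ∣ g - 1) :
        q g = 1 := by
      rw [← map_one q, Ideal.Quotient.eq, Ideal.mem_span_singleton]; exact h
    have one (g : (QuarticRing ℤ c₀ c₁ c₂ c₃)ˣ) (h : (l : QuarticRing ℤ c₀ c₁ c₂ c₃) ∣ g - 1) :
        Units.map q.toMonoidHom g = 1 := by
      ext1
      exact hq _ h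
    have aux (g z : QuarticRing ℤ c₀ c₁ c₂ c₃)
        (h : (l : QuarticRing ℤ c₀ c₁ c₂ c₃) ^ 2 ∣ g - (1 + l * z)) :
        (l : QuarticRing ℤ c₀ c₁ c₂ c₃) ∣ g - 1 := by
      obtain ⟨a, ha⟩ := h
      exact ⟨z + l * a, by linear_combination ha⟩
    have := congrArg (Units.map q.toMonoidHom) hneg
    rw [map_mul, map_mul, map_zpow, map_zpow, map_zpow, one v hv, one η₁ (aux _ _ h₁),
      one η₂ (aux _ _ h₂)] at this
    simp only [one_zpow, mul_one] at this
    have h2 : q 1 = q (-1) := by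
      have := congrArg Units.val this
      simpa using this
    rw [Ideal.Quotient.eq, Ideal.mem_span_singleton] at h2
    have h3 : (l : ℤ) ∣ 2 := ((intCast_dvd_iff (l : ℤ) (1 - -1)).1 h2).1
    have h4 : l ∣ 2 := by exact_mod_cast h3
    have h5 := (Nat.prime_dvd_prime_iff_eq hp Nat.prime_two).1 h4
    rw [h5] at hl
    exact absurd hl (by decide)
  have hpz : Prime (l : ℤ) := Nat.prime_iff_prime_int.1 hp
  have hm : ¬ (l : ℤ) ∣ m := fun hm => by
    obtain ⟨w, hw⟩ := hv
    obtain ⟨h1, h2, -⟩ := skolem_step hp hl h₁ h₂ hx2 hx3 hdet (m := m) (x := x) (y := y) (s := 0)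
      (w := w) (by linear_combination hw) (by simpa using hrel)
    exact hgcd l hp hm h1 h2
  have key (s : ℕ) : (l : ℤ) ^ s ∣ x ∧ (l : ℤ) ^ s ∣ y ∧
      (((l : ℤ) ^ (s + 1) : ℤ) : QuarticRing ℤ c₀ c₁ c₂ c₃) ∣ v - 1 := by
    induction s with
    | zero => simpa using hv
    | succ s ih =>
      obtain ⟨⟨x', rfl⟩, ⟨y', rfl⟩, w, hw⟩ := ih
      obtain ⟨h1, h2, h3⟩ := skolem_step hp hl h₁ h₂ hx2 hx3 hdet (w := w)
        (by push_cast at hw; linear_combination hw) hrel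
      refine ⟨pow_succ (l : ℤ) s ▸ mul_dvd_mul_left _ h1,
        pow_succ (l : ℤ) s ▸ mul_dvd_mul_left _ h2, ?_⟩
      have hwl : ((l : ℤ) : QuarticRing ℤ c₀ c₁ c₂ c₃) ∣ w := by
        rw [intCast_mul, intCast_dvd_iff] at h3
        rw [intCast_dvd_iff]
        exact ⟨(hpz.dvd_or_dvd h3.1).resolve_left hm, (hpz.dvd_or_dvd h3.2.1).resolve_left hm,
          (hpz.dvd_or_dvd h3.2.2.1).resolve_left hm, (hpz.dvd_or_dvd h3.2.2.2).resolve_left hm⟩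
      rw [hw, pow_succ (l : ℤ) (s + 1), Int.cast_mul]
      exact mul_dvd_mul_left _ hwl
  have h0 : (v : QuarticRing ℤ c₀ c₁ c₂ c₃) - 1 = 0 := by
    refine eq_zero_of_forall_pow_dvd hp.one_lt fun s => ?_
    refine dvd_trans ?_ (key s).2.2
    rw [pow_succ, Int.cast_mul]
    exact dvd_mul_right _ _
  ext1
  exact sub_eq_zero.1 h0

end QuarticRing

section Saturation

variable {A : Type*} [CommRing A]

/-- No nontrivial product `v ^ a * w ^ b` is, up to sign, an `r`-th power. -/
def PowerIndependent (r : ℕ) (v w : Aˣ) : Prop :=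
  ∀ (g : Aˣ) (a b : ℤ), (g ^ r * v ^ a * w ^ b = 1 ∨ g ^ r * v ^ a * w ^ b = -1) →
    (r : ℤ) ∣ a ∧ (r : ℤ) ∣ b

lemma PowerIndependent.symm {r : ℕ} {v w : Aˣ} (h : PowerIndependent r v w) :
    PowerIndependent r w v := fun g a b hg =>
  (h g b a (by rwa [mul_right_comm])).symm

/-- An element of prime order detects divisibility of exponents. -/
lemma dvd_of_zpow_eq_one {G : Type*} [Group G] {r : ℕ} (hr : r.Prime) {y : G} (h : y ^ r = 1)
    (h1 : y ≠ 1) {b : ℤ} (hb : y ^ b = 1) : (r : ℤ) ∣ b := by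
  have := Fact.mk hr
  rw [← orderOf_eq_prime h h1]
  exact orderOf_dvd_iff_zpow_eq_one.2 hb

lemma PowerIndependent.of_hom {r : ℕ} (hr : r.Prime) {v w : Aˣ} {P₁ P₂ : ℕ} [Fact P₁.Prime]
    [Fact P₂.Prime] (χ₁ : A →+* ZMod P₁) (χ₂ : A →+* ZMod P₂) {n₁ n₂ : ℕ}
    (hn₁ : r * (2 * n₁) = P₁ - 1) (hn₂ : r * (2 * n₂) = P₂ - 1)
    (hv₁ : χ₁ v ^ (2 * n₁) = 1) (hw₁ : χ₁ w ^ (2 * n₁) ≠ 1) (hv₂ : χ₂ v ^ (2 * n₂) ≠ 1) :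
    PowerIndependent r v w := by
  intro g a b hg
  have pow_eq {P n : ℕ} [Fact P.Prime] (χ : A →+* ZMod P) (hn : r * (2 * n) = P - 1) (y : Aˣ) :
      (Units.map χ.toMonoidHom y ^ (2 * n)) ^ r = 1 := by
    rw [← pow_mul, mul_comm, hn]; exact ZMod.units_pow_card_sub_one_eq_one _ _
  have key {P n : ℕ} [Fact P.Prime] (χ : A →+* ZMod P) (hn : r * (2 * n) = P - 1) :
      (Units.map χ.toMonoidHom v ^ (2 * n)) ^ a * (Units.map χ.toMonoidHom w ^ (2 * n)) ^ b
        = 1 := by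
    have h1 : (g ^ r * v ^ a * w ^ b) ^ (2 * n) = 1 := by
      rcases hg with h | h <;> rw [h]
      · exact one_pow _
      · rw [pow_mul]; simp
    have h2 := congrArg (Units.map χ.toMonoidHom) h1
    rw [map_one, map_pow, map_mul, map_mul, map_pow, map_zpow, map_zpow, mul_pow, mul_pow,
      ← pow_mul, mul_comm r, pow_mul, pow_eq χ hn, one_mul] at h2
    rw [← h2]
    simp only [← zpow_natCast, ← zpow_mul, mul_comm]
  have unit_iff {P n : ℕ} (χ : A →+* ZMod P) (y : Aˣ) :
      Units.map χ.toMonoidHom y ^ (2 * n) = 1 ↔ χ y ^ (2 * n) = 1 := by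
    rw [Units.ext_iff]; simp
  have hb : (r : ℤ) ∣ b := by
    refine dvd_of_zpow_eq_one hr (pow_eq χ₁ hn₁ w) (fun h => hw₁ ((unit_iff _ _).1 h)) ?_
    have := key χ₁ hn₁
    rwa [(unit_iff χ₁ v).2 hv₁, one_zpow, one_mul] at this
  refine ⟨dvd_of_zpow_eq_one hr (pow_eq χ₂ hn₂ v) (fun h => hv₂ ((unit_iff _ _).1 h)) ?_, hb⟩
  have := key χ₂ hn₂
  obtain ⟨b', rfl⟩ := hb
  rwa [zpow_mul _ (r : ℤ), zpow_natCast (_ ^ _) r, pow_eq χ₂ hn₂, one_zpow, mul_one] at this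

/-- If `v, w` generate a subgroup of index prime to `E`, then every unit is, up to sign, a product
of powers of `v` and `w` in each quotient whose unit group is killed by `E`. -/
lemma RankTwoUnits.exists_zpow (hA : RankTwoUnits A) {v w : Aˣ} {E : ℕ}
    (hE : ∀ r, r.Prime → r ∣ E → PowerIndependent r v w) {B : Type*} [CommRing B] (φ : A →+* B)
    (hφ : ∀ g : Aˣ, φ g ^ E = 1) (u : Aˣ) : ∃ x y : ℤ,
      Units.map φ.toMonoidHom u
        = Units.map φ.toMonoidHom v ^ x * Units.map φ.toMonoidHom w ^ y ∨
      Units.map φ.toMonoidHom u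
        = -(Units.map φ.toMonoidHom v ^ x * Units.map φ.toMonoidHom w ^ y) := by
  obtain ⟨k, a, b, h, hgcd⟩ := hA.exists_relation u v w
  have hk : IsCoprime k (E : ℤ) := by
    rw [Int.isCoprime_iff_gcd_eq_one]
    refine Nat.Coprime.gcd_eq_one (Nat.coprime_of_dvd fun r hr hrk hrE => ?_)
    have hrk' : (r : ℤ) ∣ k := Int.natCast_dvd.2 hrk
    have ⟨k', hk'⟩ := hrk'
    have := hE r hr (by simpa using hrE) (u ^ k') a b
      (by rwa [← zpow_natCast, ← zpow_mul, mul_comm k', ← hk'])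
    exact hgcd r hr hrk' this.1 this.2
  obtain ⟨m, n, hmn⟩ := hk
  set f := Units.map φ.toMonoidHom
  have hu : f u ^ E = 1 := by
    ext1; simpa [f] using hφ u
  have hrel : f u ^ k * f v ^ a * f w ^ b = 1 ∨ f u ^ k * f v ^ a * f w ^ b = -1 := by
    have hneg : f (-1) = -1 := by ext1; simp [f]
    rcases h with h | h
    · left; rw [← map_zpow, ← map_zpow, ← map_zpow, ← map_mul, ← map_mul, h, map_one]
    · right; rw [← map_zpow, ← map_zpow, ← map_zpow, ← map_mul, ← map_mul, h, hneg]
  have hu2 : f u = (f u ^ k) ^ m := by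
    conv_lhs => rw [← zpow_one (f u), ← hmn, zpow_add, zpow_mul _ n, mul_comm m k, zpow_mul]
    rw [zpow_comm (f u) n, zpow_natCast, hu, one_zpow, mul_one]
  refine ⟨-a * m, -b * m, ?_⟩
  have hs : f v ^ (-a * m) * f w ^ (-b * m) = ((f v ^ a * f w ^ b) ^ m)⁻¹ := by
    rw [mul_zpow, mul_inv, ← zpow_mul, ← zpow_mul, ← zpow_neg, ← zpow_neg, neg_mul, neg_mul]
  have hs2 : f u = (f u ^ k * f v ^ a * f w ^ b) ^ m * (f v ^ (-a * m) * f w ^ (-b * m)) := by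
    rw [hs, mul_assoc, mul_zpow (f u ^ k), ← hu2, mul_inv_cancel_right]
  rcases hrel with h | h
  · left; rw [hs2, h, one_zpow, one_mul]
  · rw [hs2, h]
    rcases Int.even_or_odd m with hm | hm
    · left; rw [hm.neg_one_zpow, one_mul]
    · right; rw [hm.neg_one_zpow, neg_one_mul]

end Saturation

namespace QuarticRing

variable {c₀ c₁ c₂ c₃ : ℤ}

/-- Reduction of coefficients modulo `M`. -/
def modHom (M : ℕ) : QuarticRing ℤ c₀ c₁ c₂ c₃ →+*
    QuarticRing (ZMod M) (c₀ : ZMod M) (c₁ : ZMod M) (c₂ : ZMod M) (c₃ : ZMod M) :=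
  mapHom (Int.castRingHom (ZMod M)) (by simp) (by simp) (by simp) (by simp)

lemma modHom_eq_iff {M : ℕ} {x y : QuarticRing ℤ c₀ c₁ c₂ c₃} :
    modHom M x = modHom M y ↔ (M : QuarticRing ℤ c₀ c₁ c₂ c₃) ∣ x - y := by
  rw [← Int.cast_natCast, intCast_dvd_iff, QuarticRing.ext_iff]
  simp only [sub_x0, sub_x1, sub_x2, sub_x3, ← ZMod.intCast_eq_intCast_iff_dvd_sub]
  simp only [modHom, mapHom, RingHom.coe_mk, MonoidHom.coe_mk, OneHom.coe_mk, eq_intCast]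
  simp only [eq_comm]

/-- Least nonnegative representatives of the coordinates modulo `M`. -/
def reduce (M : ℕ) (x : QuarticRing ℤ c₀ c₁ c₂ c₃) : QuarticRing ℤ c₀ c₁ c₂ c₃ :=
  ⟨x.x0 % M, x.x1 % M, x.x2 % M, x.x3 % M⟩

lemma modHom_eq_iff_reduce {M : ℕ} {x y : QuarticRing ℤ c₀ c₁ c₂ c₃} :
    modHom M x = modHom M y ↔ reduce M x = reduce M y := by
  simp only [QuarticRing.ext_iff, modHom, mapHom, reduce, RingHom.coe_mk, MonoidHom.coe_mk,
    OneHom.coe_mk, eq_intCast, ZMod.intCast_eq_intCast_iff, Int.ModEq]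

@[simp] lemma modHom_reduce (M : ℕ) (x : QuarticRing ℤ c₀ c₁ c₂ c₃) :
    modHom M (reduce M x) = modHom M x := by
  rw [modHom_eq_iff_reduce]; simp [reduce]

/-- Binary exponentiation modulo `M`, multiplied into an accumulator. -/
def powMod (M : ℕ) : ℕ → ℕ → QuarticRing ℤ c₀ c₁ c₂ c₃ → QuarticRing ℤ c₀ c₁ c₂ c₃ →
    QuarticRing ℤ c₀ c₁ c₂ c₃
  | 0, _, _, acc => acc
  | k + 1, n, x, acc => powMod M k (n / 2) (reduce M (x * x))
      (if n % 2 = 1 then reduce M (acc * x) else acc)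

lemma modHom_powMod (M : ℕ) {k n : ℕ} (hn : n < 2 ^ k) (x acc : QuarticRing ℤ c₀ c₁ c₂ c₃) :
    modHom M (powMod M k n x acc) = modHom M acc * modHom M x ^ n := by
  induction k generalizing n x acc with
  | zero => simp [powMod, show n = 0 by simpa using hn]
  | succ k ih =>
    rw [powMod, ih (by omega), modHom_reduce, map_mul, ← pow_two, ← pow_mul]
    split_ifs with h
    · rw [modHom_reduce, map_mul, mul_assoc, ← pow_succ', show 2 * (n / 2) + 1 = n by omega]
    · rw [show 2 * (n / 2) = n by omega]

lemma pow_card_pow_eq {l k : ℕ} [hl : Fact l.Prime] {d₀ d₁ d₂ d₃ : ZMod l}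
    (h : (⟨0, 1, 0, 0⟩ : QuarticRing (ZMod l) d₀ d₁ d₂ d₃) ^ l ^ k = ⟨0, 1, 0, 0⟩)
    (y : QuarticRing (ZMod l) d₀ d₁ d₂ d₃) : y ^ l ^ k = y := by
  have inj : Function.Injective (const : ZMod l →+* QuarticRing (ZMod l) d₀ d₁ d₂ d₃) :=
    fun a b hab => congrArg x0 hab
  have := charP_of_injective_ringHom inj l
  have hc (a : ZMod l) : (const a : QuarticRing (ZMod l) d₀ d₁ d₂ d₃) ^ l ^ k = const a := by
    rw [← map_pow, ZMod.pow_card_pow]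
  set t : QuarticRing (ZMod l) d₀ d₁ d₂ d₃ := ⟨0, 1, 0, 0⟩ with ht
  have hy : y = const y.x0 + const y.x1 * t + const y.x2 * t ^ 2 + const y.x3 * t ^ 3 := by
    rw [ht]
    simp only [const_mul, pow_succ, pow_zero, one_mul]
    ext <;> simp [const, mul_x0, mul_x1, mul_x2, mul_x3, high4, high5, high6]
  rw [hy, add_pow_char_pow, add_pow_char_pow, add_pow_char_pow, mul_pow, mul_pow, mul_pow,
    hc, hc, hc, hc, pow_right_comm t 2, pow_right_comm t 3, h]

lemma modHom_unit_pow {l k : ℕ} [hl : Fact l.Prime] {E e : ℕ} (hE : l ^ k = E + 1)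
    (he : E + 1 < 2 ^ e)
    (h : reduce l (powMod l e (E + 1) (⟨0, 1, 0, 0⟩ : QuarticRing ℤ c₀ c₁ c₂ c₃) 1)
      = reduce l ⟨0, 1, 0, 0⟩) (g : (QuarticRing ℤ c₀ c₁ c₂ c₃)ˣ) :
    modHom l (g : QuarticRing ℤ c₀ c₁ c₂ c₃) ^ E = 1 := by
  rw [← modHom_eq_iff_reduce, modHom_powMod l he, map_one, one_mul, ← hE] at h
  have h1 : modHom l (⟨0, 1, 0, 0⟩ : QuarticRing ℤ c₀ c₁ c₂ c₃) = ⟨0, 1, 0, 0⟩ := by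
    ext <;> simp [modHom, mapHom]
  rw [h1] at h
  have h2 := pow_card_pow_eq h (modHom l (g : QuarticRing ℤ c₀ c₁ c₂ c₃))
  rw [hE, pow_succ] at h2
  have hu : IsUnit (modHom l (g : QuarticRing ℤ c₀ c₁ c₂ c₃)) := g.isUnit.map _
  exact hu.mul_right_cancel (by rw [h2, one_mul])

/-- `T` holds at representatives of `x, x * v, …, x * v ^ (n - 1)` modulo `M`. -/
def scanRow (M : ℕ) (T : QuarticRing ℤ c₀ c₁ c₂ c₃ → Bool) (v : QuarticRing ℤ c₀ c₁ c₂ c₃) :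
    ℕ → QuarticRing ℤ c₀ c₁ c₂ c₃ → Bool
  | 0, _ => true
  | n + 1, x => T x && scanRow M T v n (reduce M (x * v))

/-- `T` holds at representatives of `x * v ^ i * w ^ j` modulo `M` for `i < m`, `j < n`. -/
def scan (M : ℕ) (T : QuarticRing ℤ c₀ c₁ c₂ c₃ → Bool) (v w : QuarticRing ℤ c₀ c₁ c₂ c₃) (m : ℕ) :
    ℕ → QuarticRing ℤ c₀ c₁ c₂ c₃ → Bool
  | 0, _ => true
  | n + 1, x => scanRow M T v m x && scan M T v w m n (reduce M (x * w))

lemma exists_of_scanRow {M : ℕ} {T : QuarticRing ℤ c₀ c₁ c₂ c₃ → Bool}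
    {v x : QuarticRing ℤ c₀ c₁ c₂ c₃} {n : ℕ} (h : scanRow M T v n x) {i : ℕ} (hi : i < n) :
    ∃ y, T y ∧ modHom M y = modHom M x * modHom M v ^ i := by
  induction n generalizing x i with
  | zero => simp at hi
  | succ n ih =>
    rw [scanRow, Bool.and_eq_true] at h
    cases i with
    | zero => exact ⟨x, h.1, by simp⟩
    | succ i =>
      obtain ⟨y, hy, hxy⟩ := ih h.2 (Nat.lt_of_succ_lt_succ hi)
      exact ⟨y, hy, by rw [hxy, modHom_reduce, map_mul]; ring⟩

lemma exists_of_scan {M : ℕ} {T : QuarticRing ℤ c₀ c₁ c₂ c₃ → Bool}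
    {v w x : QuarticRing ℤ c₀ c₁ c₂ c₃} {m n : ℕ} (h : scan M T v w m n x) {i j : ℕ} (hi : i < m)
    (hj : j < n) : ∃ y, T y ∧ modHom M y = modHom M x * modHom M v ^ i * modHom M w ^ j := by
  induction n generalizing x j with
  | zero => simp at hj
  | succ n ih =>
    rw [scan, Bool.and_eq_true] at h
    cases j with
    | zero => simpa using exists_of_scanRow h.1 hi
    | succ j =>
      obtain ⟨y, hy, hxy⟩ := ih h.2 (Nat.lt_of_succ_lt_succ hj)
      exact ⟨y, hy, by rw [hxy, modHom_reduce, map_mul]; ring⟩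

end QuarticRing

/-- Representatives modulo the lattice spanned by `(m, 0)` and `(b, n)`. -/
lemma exists_pow_mul_pow {A : Type*} [CommRing A] {v w : Aˣ} {m b n : ℕ} (hm : 0 < m) (hn : 0 < n)
    (h₁ : v ^ m = 1 ∨ v ^ m = -1) (h₂ : v ^ b * w ^ n = 1 ∨ v ^ b * w ^ n = -1) (x y : ℤ) :
    ∃ i < m, ∃ j < n, v ^ x * w ^ y = v ^ i * w ^ j ∨ v ^ x * w ^ y = -(v ^ i * w ^ j) := by
  have zp {g : Aˣ} (h : g = 1 ∨ g = -1) (t : ℤ) : g ^ t = 1 ∨ g ^ t = -1 := by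
    rcases h with rfl | rfl
    · left; simp
    · rcases Int.even_or_odd t with ht | ht
      · left; exact ht.neg_one_zpow
      · right; exact ht.neg_one_zpow
  set t := y / n
  set s := (x - b * t) / m
  have hm' : (0 : ℤ) < m := by exact_mod_cast hm
  have hn' : (0 : ℤ) < n := by exact_mod_cast hn
  obtain ⟨j, hj⟩ := Int.eq_ofNat_of_zero_le (Int.emod_nonneg y hn'.ne')
  obtain ⟨i, hi⟩ := Int.eq_ofNat_of_zero_le (Int.emod_nonneg (x - b * t) hm'.ne')
  have hjn := Int.emod_lt_of_pos y hn'
  have him := Int.emod_lt_of_pos (x - b * t) hm'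
  refine ⟨i, by omega, j, by omega, ?_⟩
  have hy : y = n * t + j := by rw [← hj]; exact (Int.mul_ediv_add_emod y n).symm
  have hx : x = m * s + i + b * t := by
    have := Int.mul_ediv_add_emod (x - b * t) m
    rw [hi] at this
    linarith
  have e : v ^ x * w ^ y = (v ^ m) ^ s * (v ^ b * w ^ n) ^ t * (v ^ i * w ^ j) := by
    rw [hx, hy, zpow_add, zpow_add, zpow_add, mul_zpow]
    simp only [zpow_mul, zpow_natCast, mul_assoc, mul_comm, mul_left_comm]
  rw [e]
  rcases zp h₁ s with h | h <;> rcases zp h₂ t with h' | h' <;> rw [h, h'] <;> simp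

/-- The binary quartic form with coefficients `(a, 4b, 6c, 4d, e)`. -/
def quartic (a b c d e p q : ℤ) : ℤ :=
  a * p ^ 4 + 4 * b * p ^ 3 * q + 6 * c * p ^ 2 * q ^ 2 + 4 * d * p * q ^ 3 + e * q ^ 4

/-- The sextic covariant of `quartic a b c d e`. -/
def sextic (a b c d e p q : ℤ) : ℤ :=
  (a ^ 2 * d - 3 * a * b * c + 2 * b ^ 3) * p ^ 6
  + (a ^ 2 * e + 2 * a * b * d - 9 * a * c ^ 2 + 6 * b ^ 2 * c) * p ^ 5 * q
  + 5 * (a * b * e - 3 * a * c * d + 2 * b ^ 2 * d) * p ^ 4 * q ^ 2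
  + 10 * (b ^ 2 * e - a * d ^ 2) * p ^ 3 * q ^ 3
  + 5 * (-(a * d * e) + 3 * b * c * e - 2 * b * d ^ 2) * p ^ 2 * q ^ 4
  + (-(a * e ^ 2) - 2 * b * d * e + 9 * c ^ 2 * e - 6 * c * d ^ 2) * p * q ^ 5
  + (-(b * e ^ 2) + 3 * c * d * e - 2 * d ^ 3) * q ^ 6

/-- Decides whether `g` is a square modulo `M`. -/
def isSquareMod (M : ℕ) (g : ℤ) : Bool := (List.range M).any fun z => (z * z - g) % M == 0

namespace QuarticRing

variable {c₀ c₁ c₂ c₃ : ℤ}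

/-- Decides congruence modulo `M`. -/
def congrMod (M : ℕ) (x y : QuarticRing ℤ c₀ c₁ c₂ c₃) : Bool :=
  (x.x0 - y.x0) % M == 0 && (x.x1 - y.x1) % M == 0 && (x.x2 - y.x2) % M == 0
    && (x.x3 - y.x3) % M == 0

/-- Necessary conditions modulo `M` for a unit to be `p - qθ` with `quartic 1 b c d e p q = 1` and
`5 ± 4 * sextic 1 b c d e p q` a square. -/
def isCandidate (M : ℕ) (b c d e : ℤ) (x : QuarticRing ℤ c₀ c₁ c₂ c₃) : Bool :=
  x.x2 % M == 0 && x.x3 % M == 0 && (quartic 1 b c d e x.x0 (-x.x1) - 1) % M == 0 &&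
    (isSquareMod M (5 + 4 * sextic 1 b c d e x.x0 (-x.x1)) ||
      isSquareMod M (5 - 4 * sextic 1 b c d e x.x0 (-x.x1)))

/-- Every candidate modulo `M` is congruent to `±(p - qθ)` with `(p, q)` in the list `L`. -/
def sieveTest (M : ℕ) (b c d e : ℤ) (L : List (ℤ × ℤ)) (x : QuarticRing ℤ c₀ c₁ c₂ c₃) : Bool :=
  !isCandidate M b c d e x ||
    L.any fun s => congrMod M x ⟨s.1, -s.2, 0, 0⟩ || congrMod M x ⟨-s.1, s.2, 0, 0⟩

lemma congrMod_iff {M : ℕ} {x y : QuarticRing ℤ c₀ c₁ c₂ c₃} :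
    congrMod M x y = true ↔ modHom M x = modHom M y := by
  rw [modHom_eq_iff, ← Int.cast_natCast, intCast_dvd_iff, congrMod]
  simp only [Bool.and_eq_true, beq_iff_eq, Int.dvd_iff_emod_eq_zero, sub_x0, sub_x1, sub_x2,
    sub_x3, and_assoc]

lemma isSquareMod_of_eq {M : ℕ} (hM : 0 < M) {g Z : ℤ} (h : (Z : ZMod M) ^ 2 = g) :
    isSquareMod M g = true := by
  have := NeZero.of_pos hM
  rw [isSquareMod, List.any_eq_true]
  refine ⟨(Z : ZMod M).val, List.mem_range.2 (ZMod.val_lt _), ?_⟩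
  rw [beq_iff_eq, ← Int.dvd_iff_emod_eq_zero, ← ZMod.intCast_zmod_eq_zero_iff_dvd]
  push_cast
  rw [ZMod.natCast_zmod_val, ← h]
  ring

/-- The unit `p - qθ`. -/
lemma exists_linear_unit {b c d e : ℤ} (h₀ : c₀ = -e) (h₁ : c₁ = -(4 * d)) (h₂ : c₂ = -(6 * c))
    (h₃ : c₃ = -(4 * b)) {p q : ℤ} (h : quartic 1 b c d e p q = 1) :
    ∃ u : (QuarticRing ℤ c₀ c₁ c₂ c₃)ˣ, (u : QuarticRing ℤ c₀ c₁ c₂ c₃) = ⟨p, -q, 0, 0⟩ := by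
  have key : (⟨p, -q, 0, 0⟩ * ⟨p ^ 3 - c₃ * q * p ^ 2 - c₂ * q ^ 2 * p - c₁ * q ^ 3,
      p ^ 2 * q - c₃ * p * q ^ 2 - c₂ * q ^ 3, p * q ^ 2 - c₃ * q ^ 3, q ^ 3⟩ :
      QuarticRing ℤ c₀ c₁ c₂ c₃) = 1 := by
    subst h₀ h₁ h₂ h₃
    rw [quartic] at h
    ext
    · simp only [mul_x0, high4, high5, high6, one_x0]; linear_combination h
    · simp only [mul_x1, high4, high5, high6, one_x1]; ring
    · simp only [mul_x2, high4, high5, high6, one_x2]; ring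
    · simp only [mul_x3, high4, high5, high6, one_x3]; ring
  exact ⟨Units.mkOfMulEqOne _ _ key, rfl⟩

lemma sieveTest_sound {M : ℕ} (hM : 0 < M) {b c d e : ℤ} {L : List (ℤ × ℤ)}
    {x : QuarticRing ℤ c₀ c₁ c₂ c₃} (hx : sieveTest M b c d e L x = true) {p q Z : ℤ}
    (hF : quartic 1 b c d e p q = 1)
    (hG : Z ^ 2 = 5 + 4 * sextic 1 b c d e p q ∨ Z ^ 2 = 5 - 4 * sextic 1 b c d e p q)
    (hu : modHom M x = modHom M ⟨p, -q, 0, 0⟩ ∨ modHom M x = modHom M ⟨-p, q, 0, 0⟩) :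
    ∃ s ∈ L, modHom M (⟨p, -q, 0, 0⟩ : QuarticRing ℤ c₀ c₁ c₂ c₃) = modHom M ⟨s.1, -s.2, 0, 0⟩ ∨
      modHom M (⟨p, -q, 0, 0⟩ : QuarticRing ℤ c₀ c₁ c₂ c₃) = modHom M ⟨-s.1, s.2, 0, 0⟩ := by
  have neg_mk (a b : ℤ) :
      (⟨-a, b, 0, 0⟩ : QuarticRing ℤ c₀ c₁ c₂ c₃) = -⟨a, -b, 0, 0⟩ := by
    ext <;> simp
  have hc : isCandidate M b c d e x = true := by
    have coords {y : QuarticRing ℤ c₀ c₁ c₂ c₃} (h : modHom M x = modHom M y) :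
        (x.x0 : ZMod M) = y.x0 ∧ (x.x1 : ZMod M) = y.x1 ∧ (x.x2 : ZMod M) = y.x2 ∧
          (x.x3 : ZMod M) = y.x3 :=
      ⟨congrArg QuarticRing.x0 h, congrArg QuarticRing.x1 h, congrArg QuarticRing.x2 h,
        congrArg QuarticRing.x3 h⟩
    have vals : (x.x2 : ZMod M) = 0 ∧ (x.x3 : ZMod M) = 0 ∧
        ((quartic 1 b c d e x.x0 (-x.x1) : ℤ) : ZMod M) = quartic 1 b c d e p q ∧
        ((sextic 1 b c d e x.x0 (-x.x1) : ℤ) : ZMod M) = sextic 1 b c d e p q := by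
      rcases hu with h | h
      all_goals
        obtain ⟨h0, h1, h2, h3⟩ := coords h
        refine ⟨by simpa using h2, by simpa using h3, ?_, ?_⟩
        · simp only [quartic]; push_cast; rw [h0, h1]; push_cast; ring
        · simp only [sextic]; push_cast; rw [h0, h1]; push_cast; ring
    obtain ⟨e2, e3, eF, eG⟩ := vals
    have eF' : ((quartic 1 b c d e x.x0 (-x.x1) - 1 : ℤ) : ZMod M) = 0 := by
      rw [Int.cast_sub, eF, hF]; simp
    simp only [isCandidate, Bool.and_eq_true, Bool.or_eq_true, beq_iff_eq,
      ← Int.dvd_iff_emod_eq_zero, ← ZMod.intCast_zmod_eq_zero_iff_dvd]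
    refine ⟨⟨⟨e2, e3⟩, eF'⟩, ?_⟩
    rcases hG with h | h
    · left
      apply isSquareMod_of_eq hM (Z := Z)
      rw [Int.cast_add, Int.cast_mul, eG]; exact_mod_cast congrArg (Int.cast : ℤ → ZMod M) h
    · right
      apply isSquareMod_of_eq hM (Z := Z)
      rw [Int.cast_sub, Int.cast_mul, eG]; exact_mod_cast congrArg (Int.cast : ℤ → ZMod M) h
  rw [sieveTest, hc, Bool.not_true, Bool.false_or, List.any_eq_true] at hx
  obtain ⟨s, hs, hxs⟩ := hx
  rw [Bool.or_eq_true, congrMod_iff, congrMod_iff] at hxs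
  refine ⟨s, hs, ?_⟩
  rw [neg_mk, map_neg] at hu hxs ⊢
  rcases hu with h | h <;> rcases hxs with h' | h'
  · left; rw [← h, h']
  · right; rw [← h, h']
  · right; rw [← h', h, neg_neg]
  · left; rw [← neg_inj, ← h, h']

end QuarticRing

namespace QuarticRing

variable {c₀ c₁ c₂ c₃ : ℤ}

/-- The determinant of the `θ²` and `θ³` coordinates of `z₁ * (p - qθ)` and `z₂ * (p - qθ)`. -/
def skolemDet (z₁ z₂ : QuarticRing ℤ c₀ c₁ c₂ c₃) (p q : ℤ) : ℤ :=
  (z₁ * ⟨p, -q, 0, 0⟩).x2 * (z₂ * ⟨p, -q, 0, 0⟩).x3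
    - (z₁ * ⟨p, -q, 0, 0⟩).x3 * (z₂ * ⟨p, -q, 0, 0⟩).x2

/-- `1 + l * z` -/
def oneAddMul (l : ℕ) (z : QuarticRing ℤ c₀ c₁ c₂ c₃) : QuarticRing ℤ c₀ c₁ c₂ c₃ :=
  ⟨1 + l * z.x0, l * z.x1, l * z.x2, l * z.x3⟩

lemma oneAddMul_eq (l : ℕ) (z : QuarticRing ℤ c₀ c₁ c₂ c₃) : oneAddMul l z = 1 + l * z := by
  rw [← Int.cast_natCast, intCast_mul]
  ext <;> simp [oneAddMul]

lemma modHom_val_eq_one {l : ℕ} {η : (QuarticRing ℤ c₀ c₁ c₂ c₃)ˣ}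
    {z : QuarticRing ℤ c₀ c₁ c₂ c₃} (h : (l : QuarticRing ℤ c₀ c₁ c₂ c₃) ^ 2 ∣ η - (1 + l * z)) :
    Units.map (modHom l).toMonoidHom η = 1 := by
  obtain ⟨a, ha⟩ := h
  ext1
  have : modHom l (η : QuarticRing ℤ c₀ c₁ c₂ c₃) = modHom l 1 := by
    rw [modHom_eq_iff]
    exact ⟨z + l * a, by linear_combination ha⟩
  simpa using this

/-- Combination of the sieve modulo `l` with Skolem's method. -/
theorem mem_of_scan (hU : RankTwoUnits (QuarticRing ℤ c₀ c₁ c₂ c₃)) {b c d e : ℤ}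
    (h₀ : c₀ = -e) (h₁ : c₁ = -(4 * d)) (h₂ : c₂ = -(6 * c)) (h₃ : c₃ = -(4 * b))
    (v w : (QuarticRing ℤ c₀ c₁ c₂ c₃)ˣ) {l k E f m n r : ℕ} (hl : l.Prime) (hodd : Odd l)
    (hE : l ^ k = E + 1) (hf : E + 1 < 2 ^ f)
    (hθ : congrMod l (powMod l f (E + 1) (⟨0, 1, 0, 0⟩ : QuarticRing ℤ c₀ c₁ c₂ c₃) 1)
      ⟨0, 1, 0, 0⟩ = true)
    (hind : ∀ r, r.Prime → r ∣ E → PowerIndependent r v w)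
    {s₁ s₂ : (QuarticRing ℤ c₀ c₁ c₂ c₃)ˣ} (hs₁ : s₁ = 1 ∨ s₁ = -1) (hs₂ : s₂ = 1 ∨ s₂ = -1)
    {z₁ z₂ : QuarticRing ℤ c₀ c₁ c₂ c₃} (hm : 0 < m ∧ m < 2 ^ f) (hn : 0 < n ∧ n < 2 ^ f)
    (hr : r < 2 ^ f)
    (hη₁ : congrMod (l ^ 2) (powMod (l ^ 2) f m v.1 s₁.1) (oneAddMul l z₁) = true)
    (hη₂ : congrMod (l ^ 2) (powMod (l ^ 2) f n w.1 (powMod (l ^ 2) f r v.1 s₂.1))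
      (oneAddMul l z₂) = true)
    (L : List (ℤ × ℤ)) (hscan : scan l (sieveTest l b c d e L) v.1 w.1 m n 1 = true)
    (hL : ∀ s ∈ L, quartic 1 b c d e s.1 s.2 = 1 ∧ ¬ (l : ℤ) ∣ skolemDet z₁ z₂ s.1 s.2)
    {p q Z : ℤ} (hF : quartic 1 b c d e p q = 1)
    (hG : Z ^ 2 = 5 + 4 * sextic 1 b c d e p q ∨ Z ^ 2 = 5 - 4 * sextic 1 b c d e p q) :
    ∃ s ∈ L, (p = s.1 ∧ q = s.2) ∨ (p = -s.1 ∧ q = -s.2) := by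
  have := Fact.mk hl
  have hdvd₁ : (l : QuarticRing ℤ c₀ c₁ c₂ c₃) ^ 2 ∣
      (s₁ * v ^ m : (QuarticRing ℤ c₀ c₁ c₂ c₃)ˣ) - (1 + l * z₁) := by
    rw [congrMod_iff, modHom_powMod _ hm.2, ← map_pow, ← map_mul, oneAddMul_eq,
      modHom_eq_iff] at hη₁
    push_cast at hη₁ ⊢; exact hη₁
  have hdvd₂ : (l : QuarticRing ℤ c₀ c₁ c₂ c₃) ^ 2 ∣
      (s₂ * v ^ r * w ^ n : (QuarticRing ℤ c₀ c₁ c₂ c₃)ˣ) - (1 + l * z₂) := by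
    rw [congrMod_iff, modHom_powMod _ hn.2, modHom_powMod _ hr, ← map_pow, ← map_pow, ← map_mul,
      ← map_mul, oneAddMul_eq, modHom_eq_iff] at hη₂
    push_cast at hη₂ ⊢; exact hη₂
  set φ := Units.map (modHom (c₀ := c₀) (c₁ := c₁) (c₂ := c₂) (c₃ := c₃) l).toMonoidHom with hφ
  have hneg (g : (QuarticRing ℤ c₀ c₁ c₂ c₃)ˣ) : φ (-g) = -φ g := by ext1; simp [φ]
  have sgn {s g : (QuarticRing ℤ c₀ c₁ c₂ c₃)ˣ} (hs : s = 1 ∨ s = -1) (h : φ (s * g) = 1) :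
      φ g = 1 ∨ φ g = -1 := by
    rcases hs with rfl | rfl
    · left; rwa [one_mul] at h
    · right; rw [neg_one_mul, hneg] at h; rw [← neg_eq_iff_eq_neg, h]
  have hv := sgn hs₁ (modHom_val_eq_one hdvd₁)
  have hw := sgn hs₂ (modHom_val_eq_one (by rw [mul_assoc] at hdvd₂; exact hdvd₂))
  rw [map_pow] at hv
  rw [map_mul, map_pow, map_pow] at hw
  obtain ⟨u, hu⟩ := exists_linear_unit h₀ h₁ h₂ h₃ hF
  have hθ' := congrMod_iff.1 hθ
  rw [modHom_eq_iff_reduce] at hθ'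
  obtain ⟨x, y, hxy⟩ := hU.exists_zpow hind (modHom l) (modHom_unit_pow hE hf hθ') u
  obtain ⟨i, hi, j, hj, hij⟩ := exists_pow_mul_pow hm.1 hn.1 hv hw x y
  obtain ⟨X, hTX, hX⟩ := exists_of_scan hscan hi hj
  have neg_mk (a b : ℤ) : (⟨-a, b, 0, 0⟩ : QuarticRing ℤ c₀ c₁ c₂ c₃) = -⟨a, -b, 0, 0⟩ := by
    ext <;> simp
  have huX : modHom l X = modHom l (⟨p, -q, 0, 0⟩ : QuarticRing ℤ c₀ c₁ c₂ c₃) ∨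
      modHom l X = modHom l (⟨-p, q, 0, 0⟩ : QuarticRing ℤ c₀ c₁ c₂ c₃) := by
    rw [neg_mk, map_neg, ← hu, hX, map_one, one_mul]
    have e1 : ((φ v ^ i * φ w ^ j : _ˣ) : QuarticRing (ZMod l) _ _ _ _)
        = modHom l v.1 ^ i * modHom l w.1 ^ j := by simp [φ]
    have e2 : ((φ u : _ˣ) : QuarticRing (ZMod l) _ _ _ _) = modHom l u.1 := rfl
    rw [← e1, ← e2, ← Units.val_neg, Units.val_inj, Units.val_inj]
    rcases hxy with h | h <;> rcases hij with h' | h' <;>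
      simp only [φ, h, h', neg_neg, true_or, or_true]
  obtain ⟨s, hs, hus⟩ := sieveTest_sound hl.pos hTX hF hG huX
  refine ⟨s, hs, ?_⟩
  obtain ⟨hs1, hdet⟩ := hL s hs
  obtain ⟨g, hg⟩ := exists_linear_unit h₀ h₁ h₂ h₃ hs1
  have key (g' : (QuarticRing ℤ c₀ c₁ c₂ c₃)ˣ) (hg' : g' = u ∨ g' = -u)
      (h : modHom l g'.1 = modHom l g.1) : g' = g := by
    have hx2 : (g' : QuarticRing ℤ c₀ c₁ c₂ c₃).x2 = 0 := by
      rcases hg' with rfl | rfl <;> simp only [Units.val_neg, neg_x2, hu, neg_zero]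
    have hx3 : (g' : QuarticRing ℤ c₀ c₁ c₂ c₃).x3 = 0 := by
      rcases hg' with rfl | rfl <;> simp only [Units.val_neg, neg_x3, hu, neg_zero]
    have h1 : ((g' * g⁻¹ : (QuarticRing ℤ c₀ c₁ c₂ c₃)ˣ) : QuarticRing ℤ c₀ c₁ c₂ c₃) *
        ⟨s.1, -s.2, 0, 0⟩ = g' := by
      rw [← hg, ← Units.val_mul, inv_mul_cancel_right]
    have := skolem hU hl hodd (v := g' * g⁻¹) (u₀ := ⟨s.1, -s.2, 0, 0⟩) ?_ hdvd₁ hdvd₂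
      (by rw [h1, hx2]) (by rw [h1, hx3]) hdet
    · rwa [mul_inv_eq_one] at this
    · rw [modHom_eq_iff] at h
      obtain ⟨a, ha⟩ := h
      refine ⟨a * (g⁻¹ : (QuarticRing ℤ c₀ c₁ c₂ c₃)ˣ).1, ?_⟩
      rw [Units.val_mul, ← mul_assoc, ← ha, sub_mul, Units.mul_inv]
  rcases hus with h | h
  · left
    have := congrArg Units.val (key u (Or.inl rfl) (by rw [hu, hg, h]))
    rw [hu, hg] at this
    injection this with e1 e2
    exact ⟨e1, neg_injective e2⟩
  · right
    rw [neg_mk] at h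
    have := congrArg Units.val (key (-u) (Or.inr rfl) (by
      rw [Units.val_neg, map_neg, hu, hg, h, map_neg, neg_neg]))
    rw [Units.val_neg, hu, hg] at this
    have e1 := congrArg x0 this
    have e2 := congrArg x1 this
    simp only [neg_x0, neg_x1] at e1 e2
    constructor <;> linarith

end QuarticRing

namespace QuarticRing

variable {c₀ c₁ c₂ c₃ : ℤ}

/-- The image of `x ^ n` under the character `θ ↦ t` modulo `P`. -/
def residue (P : ℕ) (t : ℤ) (n : ℕ) (x : QuarticRing ℤ c₀ c₁ c₂ c₃) : ℤ :=
  ((x.x0 + x.x1 * t + x.x2 * t ^ 2 + x.x3 * t ^ 3) % P) ^ n % P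

lemma powerIndependent_of_residue {r : ℕ} (hr : r.Prime) {v w : (QuarticRing ℤ c₀ c₁ c₂ c₃)ˣ}
    (P₁ : ℕ) (t₁ : ℤ) (n₁ : ℕ) (P₂ : ℕ) (t₂ : ℤ) (n₂ : ℕ) (hP₁ : P₁.Prime) (hP₂ : P₂.Prime)
    (hn₁ : r * (2 * n₁) = P₁ - 1) (hn₂ : r * (2 * n₂) = P₂ - 1)
    (ht₁ : (t₁ ^ 4 - (c₀ + c₁ * t₁ + c₂ * t₁ ^ 2 + c₃ * t₁ ^ 3)) % P₁ = 0)
    (ht₂ : (t₂ ^ 4 - (c₀ + c₁ * t₂ + c₂ * t₂ ^ 2 + c₃ * t₂ ^ 3)) % P₂ = 0)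
    (hv₁ : residue P₁ t₁ (2 * n₁) v.1 = 1) (hw₁ : residue P₁ t₁ (2 * n₁) w.1 ≠ 1)
    (hv₂ : residue P₂ t₂ (2 * n₂) v.1 ≠ 1) : PowerIndependent r v w := by
  have := Fact.mk hP₁
  have := Fact.mk hP₂
  have root {P : ℕ} {t : ℤ} (ht : (t ^ 4 - (c₀ + c₁ * t + c₂ * t ^ 2 + c₃ * t ^ 3)) % P = 0) :
      (t : ZMod P) ^ 4 = Int.castRingHom (ZMod P) c₀ + Int.castRingHom (ZMod P) c₁ * t
        + Int.castRingHom (ZMod P) c₂ * t ^ 2 + Int.castRingHom (ZMod P) c₃ * t ^ 3 := by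
    have h := (ZMod.intCast_zmod_eq_zero_iff_dvd _ P).2 (Int.dvd_of_emod_eq_zero ht)
    push_cast at h
    simp only [eq_intCast]
    linear_combination h
  have val {P : ℕ} (hP : P.Prime) {t : ℤ}
      (ht : (t ^ 4 - (c₀ + c₁ * t + c₂ * t ^ 2 + c₃ * t ^ 3)) % P = 0) (n : ℕ)
      (x : QuarticRing ℤ c₀ c₁ c₂ c₃) :
      evalHom (Int.castRingHom (ZMod P)) (t : ZMod P) (root ht) x ^ n = 1 ↔
        residue P t n x = 1 := by
    have h1 : evalHom (Int.castRingHom (ZMod P)) (t : ZMod P) (root ht) x ^ n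
        = (((x.x0 + x.x1 * t + x.x2 * t ^ 2 + x.x3 * t ^ 3) % P) ^ n : ℤ) := by
      rw [Int.cast_pow, ZMod.intCast_mod]
      simp [evalHom]
    have h2 : (1 : ℤ) = 1 % P := (Int.emod_eq_of_lt zero_le_one (by exact_mod_cast hP.one_lt)).symm
    rw [h1, residue]
    conv_rhs => rw [h2]
    rw [← Int.cast_one, ZMod.intCast_eq_intCast_iff, Int.ModEq]
  exact PowerIndependent.of_hom hr _ _ hn₁ hn₂ ((val hP₁ ht₁ _ _).2 hv₁)
    (fun h => hw₁ ((val hP₁ ht₁ _ _).1 h)) (fun h => hv₂ ((val hP₂ ht₂ _ _).1 h))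

end QuarticRing

lemma Nat.Prime.mem_of_dvd_prod {r n : ℕ} (hr : r.Prime) (h : r ∣ n) (L : List ℕ)
    (hL : ∀ p ∈ L, p.Prime) (hn : L.prod = n) : r ∈ L :=
  mem_list_primes_of_dvd_prod hr.prime (fun p hp => (hL p hp).prime) (hn ▸ h)

lemma powerIndependent_two {A : Type*} [CommRing A] {v w : Aˣ}
    (hv : ∀ g : A, g ^ 2 ≠ v ∧ g ^ 2 ≠ -v) (hw : ∀ g : A, g ^ 2 ≠ w ∧ g ^ 2 ≠ -w)
    (hvw : ∀ g : A, g ^ 2 ≠ v * w ∧ g ^ 2 ≠ -(v * w)) : PowerIndependent 2 v w := by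
  intro g a b hg
  have key (y : Aˣ) (hy : ∀ g : A, g ^ 2 ≠ y ∧ g ^ 2 ≠ -y) (g : Aˣ) :
      ¬ (g ^ 2 * y = 1 ∨ g ^ 2 * y = -1) := by
    rintro (h | h)
    · apply (hy ↑g⁻¹).1
      rw [← Units.val_pow_eq_pow_val, Units.val_inj, inv_pow]
      exact (eq_inv_of_mul_eq_one_right h).symm
    · apply (hy ↑g⁻¹).2
      rw [← Units.val_pow_eq_pow_val, ← Units.val_neg, Units.val_inj, inv_pow]
      exact (eq_inv_of_mul_eq_one_right (by rw [mul_neg, h, neg_neg])).symm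
  rcases Int.even_or_odd' a with ⟨a', rfl | rfl⟩ <;> rcases Int.even_or_odd' b with ⟨b', rfl | rfl⟩
  · exact ⟨dvd_mul_right _ _, dvd_mul_right _ _⟩
  · refine absurd ?_ (key w hw (g * v ^ a' * w ^ b'))
    convert hg using 2 <;> rw [mul_pow, mul_pow, ← zpow_natCast (v ^ a'), ← zpow_natCast (w ^ b'),
      ← zpow_mul, ← zpow_mul, mul_comm a', mul_comm b', zpow_add, zpow_one, ← mul_assoc] <;> rfl
  · refine absurd ?_ (key v hv (g * v ^ a' * w ^ b'))
    convert hg using 2 <;> rw [mul_pow, mul_pow, ← zpow_natCast (v ^ a'), ← zpow_natCast (w ^ b'),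
      ← zpow_mul, ← zpow_mul, mul_comm a', mul_comm b', zpow_add, zpow_one, mul_right_comm,
      ← mul_assoc] <;> rfl
  · refine absurd ?_ (key (v * w) hvw (g * v ^ a' * w ^ b'))
    convert hg using 2 <;> rw [mul_pow, mul_pow, ← zpow_natCast (v ^ a'), ← zpow_natCast (w ^ b'),
      ← zpow_mul, ← zpow_mul, mul_comm a', mul_comm b', zpow_add, zpow_one, zpow_add, zpow_one,
      ← mul_assoc, mul_right_comm _ _ v, mul_assoc _ _ v, ← mul_assoc _ _ w] <;> rfl

namespace QuarticRing

variable {c₀ c₁ c₂ c₃ : ℤ}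

/-- Decides whether `x` is not a square modulo `M`. -/
def nonsquareMod (M : ℕ) (x : QuarticRing ℤ c₀ c₁ c₂ c₃) : Bool :=
  (List.range M).all fun a => (List.range M).all fun b => (List.range M).all fun c =>
    (List.range M).all fun d =>
      let y : QuarticRing ℤ c₀ c₁ c₂ c₃ := ⟨a, b, c, d⟩ * ⟨a, b, c, d⟩
      !congrMod M y x

lemma sq_ne_of_nonsquareMod {M : ℕ} (hM : 0 < M) {x : QuarticRing ℤ c₀ c₁ c₂ c₃}
    (h : nonsquareMod M x = true) (g : QuarticRing ℤ c₀ c₁ c₂ c₃) : g ^ 2 ≠ x := by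
  have hpos (z : ℤ) : ((z % M).toNat : ℤ) = z % M :=
    Int.toNat_of_nonneg (Int.emod_nonneg _ (by omega))
  have hlt (z : ℤ) : (z % M).toNat < M := by
    have := Int.emod_lt_of_pos z (b := M) (by omega)
    have := hpos z
    omega
  simp only [nonsquareMod, List.all_eq_true, List.mem_range, Bool.not_eq_true'] at h
  have h' := h _ (hlt g.x0) _ (hlt g.x1) _ (hlt g.x2) _ (hlt g.x3)
  rw [hpos, hpos, hpos, hpos] at h'
  change congrMod M (reduce M g * reduce M g) x = false at h'
  rw [Bool.eq_false_iff, ne_eq, congrMod_iff, map_mul, modHom_reduce, ← map_mul, ← pow_two] at h'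
  exact fun e => h' (by rw [e])

/-- An element whose quadruple has a square root outside `2ℤ[θ]` is not a square. -/
lemma sq_ne_of_four_mul_eq_sq (hU : RankTwoUnits (QuarticRing ℤ c₀ c₁ c₂ c₃))
    {x y : QuarticRing ℤ c₀ c₁ c₂ c₃} (h : y * y = 4 * x) (hy : y.x3 % 2 = 1)
    (g : QuarticRing ℤ c₀ c₁ c₂ c₃) : g ^ 2 ≠ x := by
  have := hU.isDomain
  rintro rfl
  have h2 : (2 * g).x3 = 2 * g.x3 := by rw [two_mul, add_x3, two_mul]
  have : y ^ 2 = (2 * g) ^ 2 := by linear_combination h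
  rcases sq_eq_sq_iff_eq_or_eq_neg.1 this with e | e
  · rw [e, h2] at hy; omega
  · rw [e, neg_x3, h2] at hy; omega

end QuarticRing

section QuarticForms

open QuarticRing

lemma quartic_1_5_1_0_1_eq_one {p q Z : ℤ}
    (hF : quartic 1 5 1 0 1 p q = 1)
    (hG : Z ^ 2 = 5 + 4 * sextic 1 5 1 0 1 p q ∨
      Z ^ 2 = 5 - 4 * sextic 1 5 1 0 1 p q) :
    ∃ s ∈ ([(1, 0), (0, 1), (-1, 2)] : List (ℤ × ℤ)),
      (p = s.1 ∧ q = s.2) ∨ (p = -s.1 ∧ q = -s.2) := by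
  have hU : RankTwoUnits (QuarticRing ℤ (-1) 0 (-6) (-20)) :=
    rankTwoUnits
      (irreducible_poly _ _ _ _ (p := 11) (by norm_num) (by decide +kernel) (by decide +kernel))
      (by norm_num) (-1) (by norm_num)
  refine mem_of_scan hU rfl rfl rfl rfl
    (Units.mkOfMulEqOne ⟨0, 1, 0, 0⟩
      ⟨0, -6, -20, -1⟩ (by ext <;> decide +kernel))
    (Units.mkOfMulEqOne ⟨2, -6, -20, -1⟩
      ⟨8, -15, 78, 4⟩ (by ext <;> decide +kernel))
    (l := 71) (k := 1) (E := 70) (f := 7) (m := 35) (n := 70) (r := 0)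
    (s₁ := 1) (s₂ := 1) (z₁ := ⟨12, 39, 69, 64⟩) (z₂ := ⟨60, 12, 61, 27⟩)
    (by norm_num) (by decide) (by norm_num) (by norm_num) (by decide +kernel) ?_
    (Or.inl rfl) (Or.inl rfl) (by norm_num) (by norm_num) (by norm_num)
    (by decide +kernel) (by decide +kernel) [(1, 0), (0, 1), (-1, 2)]
    (by decide +kernel) (by decide +kernel) hF hG
  intro r hr hrE
  have hmem := hr.mem_of_dvd_prod hrE [2, 5, 7] (by norm_num) (by norm_num)
  obtain rfl | rfl | rfl : r = 2 ∨ r = 5 ∨ r = 7 := by simpa using hmem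
  · exact (powerIndependent_of_residue hr 13 3 3 13 5 3 (by norm_num) (by norm_num)
      (by norm_num) (by norm_num) (by norm_num) (by norm_num) (by decide +kernel)
      (by decide +kernel) (by decide +kernel))
  · exact (powerIndependent_of_residue hr 61 21 6 41 17 4 (by norm_num) (by norm_num)
      (by norm_num) (by norm_num) (by norm_num) (by norm_num) (by decide +kernel)
      (by decide +kernel) (by decide +kernel))
  · exact (powerIndependent_of_residue hr 71 25 5 29 18 2 (by norm_num) (by norm_num)
      (by norm_num) (by norm_num) (by norm_num) (by norm_num) (by decide +kernel)
      (by decide +kernel) (by decide +kernel))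

lemma quartic_1_0_2_1_neg8_eq_one {p q Z : ℤ}
    (hF : quartic 1 0 2 1 (-8) p q = 1)
    (hG : Z ^ 2 = 5 + 4 * sextic 1 0 2 1 (-8) p q ∨
      Z ^ 2 = 5 - 4 * sextic 1 0 2 1 (-8) p q) :
    ∃ s ∈ ([(1, 0), (-1, 1)] : List (ℤ × ℤ)),
      (p = s.1 ∧ q = s.2) ∨ (p = -s.1 ∧ q = -s.2) := by
  have hU : RankTwoUnits (QuarticRing ℤ 8 (-4) (-12) 0) :=
    rankTwoUnits
      (irreducible_poly _ _ _ _ (p := 7) (by norm_num) (by decide +kernel) (by decide +kernel))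
      (by norm_num) 0 (by norm_num)
  refine mem_of_scan hU rfl rfl rfl rfl
    (Units.mkOfMulEqOne ⟨9, -13, 1, -1⟩
      ⟨1, 1, 0, 0⟩ (by ext <;> decide +kernel))
    (Units.mkOfMulEqOne ⟨5513, 5619, 298, 452⟩
      ⟨-15, 9, 23, -3⟩ (by ext <;> decide +kernel))
    (l := 7) (k := 4) (E := 2400) (f := 12) (m := 10) (n := 5) (r := 6)
    (s₁ := -1) (s₂ := 1) (z₁ := ⟨1, 1, 3, 6⟩) (z₂ := ⟨0, 0, 3, 1⟩)
    (by norm_num) (by decide) (by norm_num) (by norm_num) (by decide +kernel) ?_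
    (Or.inr rfl) (Or.inl rfl) (by norm_num) (by norm_num) (by norm_num)
    (by decide +kernel) (by decide +kernel) [(1, 0), (-1, 1)]
    (by decide +kernel) (by decide +kernel) hF hG
  intro r hr hrE
  have hmem := hr.mem_of_dvd_prod hrE [2, 2, 2, 2, 2, 3, 5, 5] (by norm_num) (by norm_num)
  obtain rfl | rfl | rfl : r = 2 ∨ r = 3 ∨ r = 5 := by simpa using hmem
  · exact (powerIndependent_of_residue hr 13 8 3 13 10 3 (by norm_num) (by norm_num)
      (by norm_num) (by norm_num) (by norm_num) (by norm_num) (by decide +kernel)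
      (by decide +kernel) (by decide +kernel))
  · exact (powerIndependent_of_residue hr 13 10 2 13 8 2 (by norm_num) (by norm_num)
      (by norm_num) (by norm_num) (by norm_num) (by norm_num) (by decide +kernel)
      (by decide +kernel) (by decide +kernel)).symm
  · exact (powerIndependent_of_residue hr 41 31 4 61 23 6 (by norm_num) (by norm_num)
      (by norm_num) (by norm_num) (by norm_num) (by norm_num) (by decide +kernel)
      (by decide +kernel) (by decide +kernel))

lemma quartic_1_5_neg1_0_1_eq_one {p q Z : ℤ}
    (hF : quartic 1 5 (-1) 0 1 p q = 1)
    (hG : Z ^ 2 = 5 + 4 * sextic 1 5 (-1) 0 1 p q ∨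
      Z ^ 2 = 5 - 4 * sextic 1 5 (-1) 0 1 p q) :
    ∃ s ∈ ([(1, 0), (0, 1)] : List (ℤ × ℤ)),
      (p = s.1 ∧ q = s.2) ∨ (p = -s.1 ∧ q = -s.2) := by
  have hU : RankTwoUnits (QuarticRing ℤ (-1) 0 6 (-20)) :=
    rankTwoUnits
      (irreducible_poly _ _ _ _ (p := 7) (by norm_num) (by decide +kernel) (by decide +kernel))
      (by norm_num) (-1) (by norm_num)
  refine mem_of_scan hU rfl rfl rfl rfl
    (Units.mkOfMulEqOne ⟨0, 1, 0, 0⟩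
      ⟨0, 6, -20, -1⟩ (by ext <;> decide +kernel))
    (Units.mkOfMulEqOne ⟨2492, -8542, 14328, 727⟩
      ⟨12, -503, -1892, -92⟩ (by ext <;> decide +kernel))
    (l := 71) (k := 1) (E := 70) (f := 7) (m := 35) (n := 70) (r := 0)
    (s₁ := 1) (s₂ := 1) (z₁ := ⟨63, 1, 44, 45⟩) (z₂ := ⟨53, 66, 1, 15⟩)
    (by norm_num) (by decide) (by norm_num) (by norm_num) (by decide +kernel) ?_
    (Or.inl rfl) (Or.inl rfl) (by norm_num) (by norm_num) (by norm_num)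
    (by decide +kernel) (by decide +kernel) [(1, 0), (0, 1)]
    (by decide +kernel) (by decide +kernel) hF hG
  intro r hr hrE
  have hmem := hr.mem_of_dvd_prod hrE [2, 5, 7] (by norm_num) (by norm_num)
  obtain rfl | rfl | rfl : r = 2 ∨ r = 5 ∨ r = 7 := by simpa using hmem
  · exact (powerIndependent_of_residue hr 61 53 15 29 12 7 (by norm_num) (by norm_num)
      (by norm_num) (by norm_num) (by norm_num) (by norm_num) (by decide +kernel)
      (by decide +kernel) (by decide +kernel)).symm
  · exact (powerIndependent_of_residue hr 11 4 1 11 6 1 (by norm_num) (by norm_num)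
      (by norm_num) (by norm_num) (by norm_num) (by norm_num) (by decide +kernel)
      (by decide +kernel) (by decide +kernel)).symm
  · exact (powerIndependent_of_residue hr 71 54 5 71 3 5 (by norm_num) (by norm_num)
      (by norm_num) (by norm_num) (by norm_num) (by norm_num) (by decide +kernel)
      (by decide +kernel) (by decide +kernel))

lemma quartic_1_neg1_neg2_neg3_4_eq_one {p q Z : ℤ}
    (hF : quartic 1 (-1) (-2) (-3) 4 p q = 1)
    (hG : Z ^ 2 = 5 + 4 * sextic 1 (-1) (-2) (-3) 4 p q ∨
      Z ^ 2 = 5 - 4 * sextic 1 (-1) (-2) (-3) 4 p q) :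
    ∃ s ∈ ([(1, 0)] : List (ℤ × ℤ)),
      (p = s.1 ∧ q = s.2) ∨ (p = -s.1 ∧ q = -s.2) := by
  have hU : RankTwoUnits (QuarticRing ℤ (-4) 12 12 4) :=
    rankTwoUnits
      (irreducible_poly _ _ _ _ (p := 13) (by norm_num) (by decide +kernel) (by decide +kernel))
      (by norm_num) 1 (by norm_num)
  refine mem_of_scan hU rfl rfl rfl rfl
    (Units.mkOfMulEqOne ⟨5, 5, 2, 0⟩
      ⟨1, -5, 7, -1⟩ (by ext <;> decide +kernel))
    (Units.mkOfMulEqOne ⟨4551, 3840, 1107, -296⟩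
      ⟨-5, 20, -3, 0⟩ (by ext <;> decide +kernel))
    (l := 5) (k := 2) (E := 24) (f := 5) (m := 6) (n := 1) (r := 1)
    (s₁ := -1) (s₂ := 1) (z₁ := ⟨1, 2, 2, 2⟩) (z₂ := ⟨3, 3, 0, 4⟩)
    (by norm_num) (by decide) (by norm_num) (by norm_num) (by decide +kernel) ?_
    (Or.inr rfl) (Or.inl rfl) (by norm_num) (by norm_num) (by norm_num)
    (by decide +kernel) (by decide +kernel) [(1, 0)]
    (by decide +kernel) (by decide +kernel) hF hG
  intro r hr hrE
  have hmem := hr.mem_of_dvd_prod hrE [2, 2, 2, 3] (by norm_num) (by norm_num)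
  obtain rfl | rfl : r = 2 ∨ r = 3 := by simpa using hmem
  · refine powerIndependent_two ?_ ?_ ?_
    · exact fun g => ⟨sq_ne_of_nonsquareMod (M := 2) (by norm_num) (by decide +kernel) g,
        sq_ne_of_nonsquareMod (M := 2) (by norm_num) (by decide +kernel) g⟩
    · exact fun g => ⟨sq_ne_of_nonsquareMod (M := 3) (by norm_num) (by decide +kernel) g,
        sq_ne_of_nonsquareMod (M := 4) (by norm_num) (by decide +kernel) g⟩
    · exact fun g => ⟨sq_ne_of_nonsquareMod (M := 2) (by norm_num) (by decide +kernel) g,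
        sq_ne_of_nonsquareMod (M := 2) (by norm_num) (by decide +kernel) g⟩
  · exact (powerIndependent_of_residue hr 7 5 1 7 2 1 (by norm_num) (by norm_num)
      (by norm_num) (by norm_num) (by norm_num) (by norm_num) (by decide +kernel)
      (by decide +kernel) (by decide +kernel)).symm

lemma quartic_1_0_0_neg5_4_eq_one {p q Z : ℤ}
    (hF : quartic 1 0 0 (-5) 4 p q = 1)
    (hG : Z ^ 2 = 5 + 4 * sextic 1 0 0 (-5) 4 p q ∨
      Z ^ 2 = 5 - 4 * sextic 1 0 0 (-5) 4 p q) :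
    ∃ s ∈ ([(1, 0), (1, 5)] : List (ℤ × ℤ)),
      (p = s.1 ∧ q = s.2) ∨ (p = -s.1 ∧ q = -s.2) := by
  have hU : RankTwoUnits (QuarticRing ℤ (-4) 20 0 0) :=
    rankTwoUnits
      (irreducible_poly _ _ _ _ (p := 7) (by norm_num) (by decide +kernel) (by decide +kernel))
      (by norm_num) 1 (by norm_num)
  refine mem_of_scan hU rfl rfl rfl rfl
    (Units.mkOfMulEqOne ⟨23, -135, -51, -19⟩
      ⟨3, -17, 6, 0⟩ (by ext <;> decide +kernel))
    (Units.mkOfMulEqOne ⟨2499, -5, -25, -125⟩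
      ⟨-1, 5, 0, 0⟩ (by ext <;> decide +kernel))
    (l := 7) (k := 4) (E := 2400) (f := 12) (m := 50) (n := 1) (r := 29)
    (s₁ := -1) (s₂ := 1) (z₁ := ⟨1, 5, 0, 6⟩) (z₂ := ⟨1, 3, 4, 6⟩)
    (by norm_num) (by decide) (by norm_num) (by norm_num) (by decide +kernel) ?_
    (Or.inr rfl) (Or.inl rfl) (by norm_num) (by norm_num) (by norm_num)
    (by decide +kernel) (by decide +kernel) [(1, 0), (1, 5)]
    (by decide +kernel) (by decide +kernel) hF hG
  intro r hr hrE
  have hmem := hr.mem_of_dvd_prod hrE [2, 2, 2, 2, 2, 3, 5, 5] (by norm_num) (by norm_num)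
  obtain rfl | rfl | rfl : r = 2 ∨ r = 3 ∨ r = 5 := by simpa using hmem
  · refine powerIndependent_two ?_ ?_ ?_
    · exact fun g => ⟨sq_ne_of_nonsquareMod (M := 2) (by norm_num) (by decide +kernel) g,
        sq_ne_of_nonsquareMod (M := 2) (by norm_num) (by decide +kernel) g⟩
    · exact fun g => ⟨sq_ne_of_nonsquareMod (M := 2) (by norm_num) (by decide +kernel) g,
        sq_ne_of_nonsquareMod (M := 2) (by norm_num) (by decide +kernel) g⟩
    · exact fun g => ⟨sq_ne_of_nonsquareMod (M := 4) (by norm_num) (by decide +kernel) g,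
        sq_ne_of_nonsquareMod (M := 3) (by norm_num) (by decide +kernel) g⟩
  · exact (powerIndependent_of_residue hr 19 10 3 37 21 6 (by norm_num) (by norm_num)
      (by norm_num) (by norm_num) (by norm_num) (by norm_num) (by decide +kernel)
      (by decide +kernel) (by decide +kernel)).symm
  · exact (powerIndependent_of_residue hr 61 35 6 41 12 4 (by norm_num) (by norm_num)
      (by norm_num) (by norm_num) (by norm_num) (by norm_num) (by decide +kernel)
      (by decide +kernel) (by decide +kernel))

lemma quartic_1_0_2_5_neg8_eq_one {p q Z : ℤ}
    (hF : quartic 1 0 2 5 (-8) p q = 1)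
    (hG : Z ^ 2 = 5 + 4 * sextic 1 0 2 5 (-8) p q ∨
      Z ^ 2 = 5 - 4 * sextic 1 0 2 5 (-8) p q) :
    ∃ s ∈ ([(1, 0), (1, 3)] : List (ℤ × ℤ)),
      (p = s.1 ∧ q = s.2) ∨ (p = -s.1 ∧ q = -s.2) := by
  have hU : RankTwoUnits (QuarticRing ℤ 8 (-20) (-12) 0) :=
    rankTwoUnits
      (irreducible_poly _ _ _ _ (p := 17) (by norm_num) (by decide +kernel) (by decide +kernel))
      (by norm_num) 0 (by norm_num)
  refine mem_of_scan hU rfl rfl rfl rfl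
    (Units.mkOfMulEqOne ⟨1, -3, 0, 0⟩
      ⟨649, 327, 9, 27⟩ (by ext <;> decide +kernel))
    (Units.mkOfMulEqOne ⟨8889, -26958, 3060, -1820⟩
      ⟨-119, 302, 176, -28⟩ (by ext <;> decide +kernel))
    (l := 113) (k := 1) (E := 112) (f := 7) (m := 56) (n := 112) (r := 0)
    (s₁ := 1) (s₂ := 1) (z₁ := ⟨19, 105, 112, 77⟩) (z₂ := ⟨87, 7, 95, 13⟩)
    (by norm_num) (by decide) (by norm_num) (by norm_num) (by decide +kernel) ?_
    (Or.inl rfl) (Or.inl rfl) (by norm_num) (by norm_num) (by norm_num)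
    (by decide +kernel) (by decide +kernel) [(1, 0), (1, 3)]
    (by decide +kernel) (by decide +kernel) hF hG
  intro r hr hrE
  have hmem := hr.mem_of_dvd_prod hrE [2, 2, 2, 2, 7] (by norm_num) (by norm_num)
  obtain rfl | rfl : r = 2 ∨ r = 7 := by simpa using hmem
  · exact (powerIndependent_of_residue hr 5 4 1 5 1 1 (by norm_num) (by norm_num)
      (by norm_num) (by norm_num) (by norm_num) (by norm_num) (by decide +kernel)
      (by decide +kernel) (by decide +kernel))
  · exact (powerIndependent_of_residue hr 43 38 3 71 41 5 (by norm_num) (by norm_num)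
      (by norm_num) (by norm_num) (by norm_num) (by norm_num) (by decide +kernel)
      (by decide +kernel) (by decide +kernel)).symm

lemma quartic_1_neg2_0_neg1_12_eq_one {p q Z : ℤ}
    (hF : quartic 1 (-2) 0 (-1) 12 p q = 1)
    (hG : Z ^ 2 = 5 + 4 * sextic 1 (-2) 0 (-1) 12 p q ∨
      Z ^ 2 = 5 - 4 * sextic 1 (-2) 0 (-1) 12 p q) :
    ∃ s ∈ ([] : List (ℤ × ℤ)),
      (p = s.1 ∧ q = s.2) ∨ (p = -s.1 ∧ q = -s.2) := by
  have hU : RankTwoUnits (QuarticRing ℤ (-12) 4 0 8) :=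
    rankTwoUnits
      (irreducible_poly _ _ _ _ (p := 19) (by norm_num) (by decide +kernel) (by decide +kernel))
      (by norm_num) 2 (by norm_num)
  refine mem_of_scan hU rfl rfl rfl rfl
    (Units.mkOfMulEqOne ⟨11, 7, 7, -1⟩
      ⟨-1, 1, 0, 0⟩ (by ext <;> decide +kernel))
    (Units.mkOfMulEqOne ⟨10534801, -30299486, 21736680, -2255380⟩
      ⟨26220529, -5611682, -781732, -17658004⟩ (by ext <;> decide +kernel))
    (l := 5) (k := 2) (E := 24) (f := 5) (m := 12) (n := 1) (r := 1)
    (s₁ := 1) (s₂ := -1) (z₁ := ⟨4, 1, 1, 3⟩) (z₂ := ⟨4, 4, 0, 3⟩)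
    (by norm_num) (by decide) (by norm_num) (by norm_num) (by decide +kernel) ?_
    (Or.inl rfl) (Or.inr rfl) (by norm_num) (by norm_num) (by norm_num)
    (by decide +kernel) (by decide +kernel) [] (by decide +kernel) (by decide +kernel) hF hG
  intro r hr hrE
  have hmem := hr.mem_of_dvd_prod hrE [2, 2, 2, 3] (by norm_num) (by norm_num)
  obtain rfl | rfl : r = 2 ∨ r = 3 := by simpa using hmem
  · refine powerIndependent_two ?_ ?_ ?_
    · exact fun g => ⟨sq_ne_of_nonsquareMod (M := 2) (by norm_num) (by decide +kernel) g,
        sq_ne_of_nonsquareMod (M := 2) (by norm_num) (by decide +kernel) g⟩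
    · exact fun g => ⟨sq_ne_of_nonsquareMod (M := 4) (by norm_num) (by decide +kernel) g,
        sq_ne_of_nonsquareMod (M := 3) (by norm_num) (by decide +kernel) g⟩
    · exact fun g => ⟨sq_ne_of_nonsquareMod (M := 2) (by norm_num) (by decide +kernel) g,
        sq_ne_of_nonsquareMod (M := 2) (by norm_num) (by decide +kernel) g⟩
  · exact (powerIndependent_of_residue hr 61 54 10 13 4 2 (by norm_num) (by norm_num)
      (by norm_num) (by norm_num) (by norm_num) (by norm_num) (by decide +kernel)
      (by decide +kernel) (by decide +kernel))

lemma quartic_1_0_neg2_1_neg8_eq_one {p q Z : ℤ}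
    (hF : quartic 1 0 (-2) 1 (-8) p q = 1)
    (hG : Z ^ 2 = 5 + 4 * sextic 1 0 (-2) 1 (-8) p q ∨
      Z ^ 2 = 5 - 4 * sextic 1 0 (-2) 1 (-8) p q) :
    ∃ s ∈ ([(1, 0)] : List (ℤ × ℤ)),
      (p = s.1 ∧ q = s.2) ∨ (p = -s.1 ∧ q = -s.2) := by
  have hU : RankTwoUnits (QuarticRing ℤ 8 (-4) 12 0) :=
    rankTwoUnits
      (irreducible_poly _ _ _ _ (p := 7) (by norm_num) (by decide +kernel) (by decide +kernel))
      (by norm_num) 0 (by norm_num)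
  refine mem_of_scan hU rfl rfl rfl rfl
    (Units.mkOfMulEqOne ⟨3, -5, 8, -2⟩
      ⟨35, -7, 51, 15⟩ (by ext <;> decide +kernel))
    (Units.mkOfMulEqOne ⟨1827, -495, 2687, 587⟩
      ⟨11875, -28013, -276, 2210⟩ (by ext <;> decide +kernel))
    (l := 5) (k := 3) (E := 124) (f := 7) (m := 31) (n := 1) (r := 30)
    (s₁ := -1) (s₂ := 1) (z₁ := ⟨3, 1, 3, 2⟩) (z₂ := ⟨3, 2, 0, 1⟩)
    (by norm_num) (by decide) (by norm_num) (by norm_num) (by decide +kernel) ?_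
    (Or.inr rfl) (Or.inl rfl) (by norm_num) (by norm_num) (by norm_num)
    (by decide +kernel) (by decide +kernel) [(1, 0)]
    (by decide +kernel) (by decide +kernel) hF hG
  intro r hr hrE
  have hmem := hr.mem_of_dvd_prod hrE [2, 2, 31] (by norm_num) (by norm_num)
  obtain rfl | rfl : r = 2 ∨ r = 31 := by simpa using hmem
  · refine powerIndependent_two ?_ ?_ ?_
    · exact fun g => ⟨sq_ne_of_nonsquareMod (M := 2) (by norm_num) (by decide +kernel) g,
        sq_ne_of_nonsquareMod (M := 2) (by norm_num) (by decide +kernel) g⟩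
    · exact fun g => ⟨sq_ne_of_nonsquareMod (M := 2) (by norm_num) (by decide +kernel) g,
        sq_ne_of_nonsquareMod (M := 2) (by norm_num) (by decide +kernel) g⟩
    · exact fun g => ⟨sq_ne_of_four_mul_eq_sq hU (y := ⟨62, -48, 106, -29⟩)
        (by ext <;> decide +kernel) (by decide +kernel) g,
        sq_ne_of_nonsquareMod (M := 3) (by norm_num) (by decide +kernel) g⟩
  · exact (powerIndependent_of_residue hr 1427 46 23 1117 939 18 (by norm_num) (by norm_num)
      (by norm_num) (by norm_num) (by norm_num) (by norm_num) (by decide +kernel)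
      (by decide +kernel) (by decide +kernel)).symm

lemma quartic_1_3_0_neg1_neg8_eq_one {p q Z : ℤ}
    (hF : quartic 1 3 0 (-1) (-8) p q = 1)
    (hG : Z ^ 2 = 5 + 4 * sextic 1 3 0 (-1) (-8) p q ∨
      Z ^ 2 = 5 - 4 * sextic 1 3 0 (-1) (-8) p q) :
    ∃ s ∈ ([] : List (ℤ × ℤ)),
      (p = s.1 ∧ q = s.2) ∨ (p = -s.1 ∧ q = -s.2) := by
  have hU : RankTwoUnits (QuarticRing ℤ 8 4 0 (-12)) :=
    rankTwoUnits
      (irreducible_poly _ _ _ _ (p := 13) (by norm_num) (by decide +kernel) (by decide +kernel))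
      (by norm_num) 0 (by norm_num)
  refine mem_of_scan hU rfl rfl rfl rfl
    (Units.mkOfMulEqOne ⟨9, 13, 13, 1⟩
      ⟨1, -1, 0, 0⟩ (by ext <;> decide +kernel))
    (Units.mkOfMulEqOne ⟨-1558106725393559547, -649052464724581389, 54050114862559069,
        2332500467059798787⟩
      ⟨528453411621196373, -840215271673138847, 276480275470498332, 29249793600828788⟩
      (by ext <;> decide +kernel))
    (l := 5) (k := 2) (E := 24) (f := 5) (m := 12) (n := 2) (r := 6)
    (s₁ := 1) (s₂ := -1) (z₁ := ⟨0, 1, 3, 0⟩) (z₂ := ⟨0, 4, 2, 0⟩)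
    (by norm_num) (by decide) (by norm_num) (by norm_num) (by decide +kernel) ?_
    (Or.inl rfl) (Or.inr rfl) (by norm_num) (by norm_num) (by norm_num)
    (by decide +kernel) (by decide +kernel) [] (by decide +kernel) (by decide +kernel) hF hG
  intro r hr hrE
  have hmem := hr.mem_of_dvd_prod hrE [2, 2, 2, 3] (by norm_num) (by norm_num)
  obtain rfl | rfl : r = 2 ∨ r = 3 := by simpa using hmem
  · refine powerIndependent_two ?_ ?_ ?_
    · exact fun g => ⟨sq_ne_of_nonsquareMod (M := 2) (by norm_num) (by decide +kernel) g,
        sq_ne_of_nonsquareMod (M := 2) (by norm_num) (by decide +kernel) g⟩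
    · exact fun g => ⟨sq_ne_of_nonsquareMod (M := 2) (by norm_num) (by decide +kernel) g,
        sq_ne_of_nonsquareMod (M := 2) (by norm_num) (by decide +kernel) g⟩
    · exact fun g => ⟨sq_ne_of_nonsquareMod (M := 4) (by norm_num) (by decide +kernel) g,
        sq_ne_of_nonsquareMod (M := 3) (by norm_num) (by decide +kernel) g⟩
  · exact (powerIndependent_of_residue hr 37 15 6 7 3 1 (by norm_num) (by norm_num)
      (by norm_num) (by norm_num) (by norm_num) (by norm_num) (by decide +kernel)
      (by decide +kernel) (by decide +kernel))

lemma quartic_1_1_neg3_2_neg15_eq_one {p q Z : ℤ}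
    (hF : quartic 1 1 (-3) 2 (-15) p q = 1)
    (hG : Z ^ 2 = 5 + 4 * sextic 1 1 (-3) 2 (-15) p q ∨
      Z ^ 2 = 5 - 4 * sextic 1 1 (-3) 2 (-15) p q) :
    ∃ s ∈ ([] : List (ℤ × ℤ)),
      (p = s.1 ∧ q = s.2) ∨ (p = -s.1 ∧ q = -s.2) := by
  have hU : RankTwoUnits (QuarticRing ℤ 15 (-8) 18 (-4)) :=
    rankTwoUnits
      (irreducible_poly _ _ _ _ (p := 13) (by norm_num) (by decide +kernel) (by decide +kernel))
      (by norm_num) 0 (by norm_num)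
  refine mem_of_scan hU rfl rfl rfl rfl
    (Units.mkOfMulEqOne ⟨8378, -5692, 10885, -3824⟩
      ⟨212, -16, 267, 40⟩ (by ext <;> decide +kernel))
    (Units.mkOfMulEqOne ⟨651328, 7633, -75590, -9174⟩
      ⟨-2991338, 444084, -3418708, -518085⟩ (by ext <;> decide +kernel))
    (l := 5) (k := 2) (E := 24) (f := 5) (m := 12) (n := 1) (r := 11)
    (s₁ := 1) (s₂ := 1) (z₁ := ⟨0, 1, 4, 1⟩) (z₂ := ⟨0, 1, 4, 1⟩)
    (by norm_num) (by decide) (by norm_num) (by norm_num) (by decide +kernel) ?_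
    (Or.inl rfl) (Or.inl rfl) (by norm_num) (by norm_num) (by norm_num)
    (by decide +kernel) (by decide +kernel) [] (by decide +kernel) (by decide +kernel) hF hG
  intro r hr hrE
  have hmem := hr.mem_of_dvd_prod hrE [2, 2, 2, 3] (by norm_num) (by norm_num)
  obtain rfl | rfl : r = 2 ∨ r = 3 := by simpa using hmem
  · refine powerIndependent_two ?_ ?_ ?_
    · exact fun g => ⟨sq_ne_of_nonsquareMod (M := 3) (by norm_num) (by decide +kernel) g,
        sq_ne_of_nonsquareMod (M := 5) (by norm_num) (by decide +kernel) g⟩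
    · exact fun g => ⟨sq_ne_of_nonsquareMod (M := 2) (by norm_num) (by decide +kernel) g,
        sq_ne_of_nonsquareMod (M := 2) (by norm_num) (by decide +kernel) g⟩
    · exact fun g => ⟨sq_ne_of_nonsquareMod (M := 2) (by norm_num) (by decide +kernel) g,
        sq_ne_of_nonsquareMod (M := 2) (by norm_num) (by decide +kernel) g⟩
  · exact (powerIndependent_of_residue hr 19 11 3 7 5 1 (by norm_num) (by norm_num)
      (by norm_num) (by norm_num) (by norm_num) (by norm_num) (by decide +kernel)
      (by decide +kernel) (by decide +kernel))

lemma quartic_1_1_neg2_neg3_neg20_eq_one {p q Z : ℤ}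
    (hF : quartic 1 1 (-2) (-3) (-20) p q = 1)
    (hG : Z ^ 2 = 5 + 4 * sextic 1 1 (-2) (-3) (-20) p q ∨
      Z ^ 2 = 5 - 4 * sextic 1 1 (-2) (-3) (-20) p q) :
    ∃ s ∈ ([(1, 0)] : List (ℤ × ℤ)),
      (p = s.1 ∧ q = s.2) ∨ (p = -s.1 ∧ q = -s.2) := by
  have hU : RankTwoUnits (QuarticRing ℤ 20 12 12 (-4)) :=
    rankTwoUnits
      (irreducible_poly _ _ _ _ (p := 37) (by norm_num) (by decide +kernel) (by decide +kernel))
      (by norm_num) 0 (by norm_num)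
  refine mem_of_scan hU rfl rfl rfl rfl
    (Units.mkOfMulEqOne ⟨683, 655, 645, 95⟩
      ⟨-153, -295, 70, 20⟩ (by ext <;> decide +kernel))
    (Units.mkOfMulEqOne ⟨7107, -80500, 14995, 5000⟩
      ⟨1075475112743, 460224298600, 566092660845, -312504569200⟩ (by ext <;> decide +kernel))
    (l := 71) (k := 1) (E := 70) (f := 7) (m := 35) (n := 35) (r := 0)
    (s₁ := -1) (s₂ := -1) (z₁ := ⟨56, 45, 8, 50⟩) (z₂ := ⟨19, 68, 26, 66⟩)
    (by norm_num) (by decide) (by norm_num) (by norm_num) (by decide +kernel) ?_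
    (Or.inr rfl) (Or.inr rfl) (by norm_num) (by norm_num) (by norm_num)
    (by decide +kernel) (by decide +kernel) [(1, 0)]
    (by decide +kernel) (by decide +kernel) hF hG
  intro r hr hrE
  have hmem := hr.mem_of_dvd_prod hrE [2, 5, 7] (by norm_num) (by norm_num)
  obtain rfl | rfl | rfl : r = 2 ∨ r = 5 ∨ r = 7 := by simpa using hmem
  · refine powerIndependent_two ?_ ?_ ?_
    · exact fun g => ⟨sq_ne_of_nonsquareMod (M := 2) (by norm_num) (by decide +kernel) g,
        sq_ne_of_nonsquareMod (M := 2) (by norm_num) (by decide +kernel) g⟩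
    · exact fun g => ⟨sq_ne_of_nonsquareMod (M := 3) (by norm_num) (by decide +kernel) g,
        sq_ne_of_nonsquareMod (M := 4) (by norm_num) (by decide +kernel) g⟩
    · exact fun g => ⟨sq_ne_of_nonsquareMod (M := 2) (by norm_num) (by decide +kernel) g,
        sq_ne_of_nonsquareMod (M := 2) (by norm_num) (by decide +kernel) g⟩
  · exact (powerIndependent_of_residue hr 61 11 6 11 2 1 (by norm_num) (by norm_num)
      (by norm_num) (by norm_num) (by norm_num) (by norm_num) (by decide +kernel)
      (by decide +kernel) (by decide +kernel)).symm
  · exact (powerIndependent_of_residue hr 43 11 3 71 13 5 (by norm_num) (by norm_num)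
      (by norm_num) (by norm_num) (by norm_num) (by norm_num) (by decide +kernel)
      (by decide +kernel) (by decide +kernel))

end QuarticForms

/-- Coefficients of the binary quartic form `a p⁴ + 4b p³q + 6c p²q² + 4d pq³ + e q⁴`. -/
structure BinaryQuartic where
  a : ℤ
  b : ℤ
  c : ℤ
  d : ℤ
  e : ℤ
deriving DecidableEq

namespace BinaryQuartic

variable {f : BinaryQuartic}

/-- The value of a form. -/
def eval (f : BinaryQuartic) (p q : ℤ) : ℤ := quartic f.a f.b f.c f.d f.e p q

/-- The value of the Hessian covariant. -/
def hessian (f : BinaryQuartic) (p q : ℤ) : ℤ :=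
  (f.b * p ^ 2 + 2 * f.c * p * q + f.d * q ^ 2) ^ 2
    - (f.a * p ^ 2 + 2 * f.b * p * q + f.c * q ^ 2)
      * (f.c * p ^ 2 + 2 * f.d * p * q + f.e * q ^ 2)

/-- The invariant of degree two. -/
def g₂ (f : BinaryQuartic) : ℤ := f.a * f.e - 4 * f.b * f.d + 3 * f.c ^ 2

/-- The invariant of degree three. -/
def g₃ (f : BinaryQuartic) : ℤ :=
  f.a * f.c * f.e + 2 * f.b * f.c * f.d - f.a * f.d ^ 2 - f.b ^ 2 * f.e - f.c ^ 3

/-- The condition on `p, q` inherited from the discriminant `5 + 4X` of `m² - 3m + 1 = X`. -/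
def IsAdmissible (f : BinaryQuartic) (p q : ℤ) : Prop :=
  f.eval p q = 1 ∧ ∃ Z : ℤ, Z ^ 2 = 5 + 4 * sextic f.a f.b f.c f.d f.e p q ∨
    Z ^ 2 = 5 - 4 * sextic f.a f.b f.c f.d f.e p q

/-- The Hessian is small at all admissible points. -/
def IsTame (f : BinaryQuartic) : Prop := ∀ p q, f.IsAdmissible p q → f.hessian p q < 1000

/-- The form `f(p + kq, q)`. -/
def translate (f : BinaryQuartic) (k : ℤ) : BinaryQuartic :=
  ⟨f.a, f.b + f.a * k, f.c + 2 * f.b * k + f.a * k ^ 2,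
    f.d + 3 * f.c * k + 3 * f.b * k ^ 2 + f.a * k ^ 3,
    f.e + 4 * f.d * k + 6 * f.c * k ^ 2 + 4 * f.b * k ^ 3 + f.a * k ^ 4⟩

/-- The form `f(-q, p)`. -/
def swap (f : BinaryQuartic) : BinaryQuartic := ⟨f.e, -f.d, f.c, -f.b, f.a⟩

/-- The form `f(p, -q)`. -/
def reflect (f : BinaryQuartic) : BinaryQuartic := ⟨f.a, -f.b, f.c, -f.d, f.e⟩

/-- Alternately translate by the entries of a word and swap. -/
def act (f : BinaryQuartic) (w : List ℤ) : BinaryQuartic :=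
  w.foldl (fun g k => (g.translate k).swap) f

lemma eval_translate (k p q : ℤ) : (f.translate k).eval (p - k * q) q = f.eval p q := by
  simp only [eval, quartic, translate]; ring

lemma hessian_translate (k p q : ℤ) : (f.translate k).hessian (p - k * q) q = f.hessian p q := by
  simp only [hessian, translate]; ring

lemma eval_swap (p q : ℤ) : f.swap.eval q (-p) = f.eval p q := by
  simp only [eval, quartic, swap]; ring

lemma hessian_swap (p q : ℤ) : f.swap.hessian q (-p) = f.hessian p q := by
  simp only [hessian, swap]; ring

lemma eval_reflect (p q : ℤ) : f.reflect.eval p (-q) = f.eval p q := by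
  simp only [eval, quartic, reflect]; ring

lemma hessian_reflect (p q : ℤ) : f.reflect.hessian p (-q) = f.hessian p q := by
  simp only [hessian, reflect]; ring

lemma sextic_translate (k p q : ℤ) :
    sextic (f.translate k).a (f.translate k).b (f.translate k).c (f.translate k).d
      (f.translate k).e (p - k * q) q = sextic f.a f.b f.c f.d f.e p q := by
  simp only [sextic, translate]; ring

lemma IsTame.of_translate {k : ℤ} (h : (f.translate k).IsTame) : f.IsTame := by
  rintro p q ⟨h1, Z, hZ⟩
  rw [← hessian_translate k]
  exact h _ _ ⟨by rw [eval_translate, h1], Z, by rwa [sextic_translate]⟩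

lemma IsTame.of_swap (h : f.swap.IsTame) : f.IsTame := by
  rintro p q ⟨h1, Z, hZ⟩
  rw [← hessian_swap]
  refine h _ _ ⟨by rw [eval_swap, h1], Z, ?_⟩
  convert hZ using 3 <;> simp only [sextic, swap] <;> ring

lemma IsTame.of_reflect (h : f.reflect.IsTame) : f.IsTame := by
  rintro p q ⟨h1, Z, hZ⟩
  rw [← hessian_reflect]
  refine h _ _ ⟨by rw [eval_reflect, h1], Z, hZ.symm.imp (fun h => ?_) fun h => ?_⟩ <;>
    rw [h] <;> simp only [sextic, reflect] <;> ring

lemma IsTame.of_act {w : List ℤ} (h : (f.act w).IsTame) : f.IsTame := by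
  induction w generalizing f with
  | nil => exact h
  | cons k w ih => exact (ih h).of_swap.of_translate

lemma g₂_translate (k : ℤ) : (f.translate k).g₂ = f.g₂ := by simp only [g₂, translate]; ring

lemma g₃_translate (k : ℤ) : (f.translate k).g₃ = f.g₃ := by simp only [g₃, translate]; ring

lemma g₂_reflect : f.reflect.g₂ = f.g₂ := by simp only [g₂, reflect]; ring

lemma g₃_reflect : f.reflect.g₃ = f.g₃ := by simp only [g₃, reflect]; ring

lemma g₂_act (w : List ℤ) : (f.act w).g₂ = f.g₂ := by
  induction w generalizing f with
  | nil => rfl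
  | cons k w ih => exact ih.trans (by simp only [g₂, translate, swap]; ring)

lemma g₃_act (w : List ℤ) : (f.act w).g₃ = f.g₃ := by
  induction w generalizing f with
  | nil => rfl
  | cons k w ih => exact ih.trans (by simp only [g₃, translate, swap]; ring)

/-- A primitive value of a form and of its Hessian is taken at `(1, 0)` by an equivalent form. -/
lemma exists_act_eval_eq {p q : ℤ} (h : IsCoprime p q) :
    ∃ w, (f.act w).eval 1 0 = f.eval p q ∧ (f.act w).hessian 1 0 = f.hessian p q := by
  induction hn : q.natAbs using Nat.strong_induction_on generalizing f p q with
  | _ n ih =>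
    rcases eq_or_ne q 0 with rfl | hq
    · rw [isCoprime_zero_right, Int.isUnit_iff] at h
      exact ⟨[], by rcases h with rfl | rfl <;> simp [act, eval, quartic, hessian]⟩
    · have hcop : IsCoprime q (-(p - p / q * q)) := by
        rw [IsCoprime.neg_right_iff]
        have := (IsCoprime.add_mul_right_left (x := p) (y := q) h (-(p / q))).symm
        convert this using 1
        ring
      obtain ⟨w, hw⟩ := ih _ (by
        have := Int.emod_lt_abs p hq
        have := Int.emod_nonneg p hq
        have := Int.emod_add_mul_ediv p q
        rw [show -(p - p / q * q) = -(p % q) by linarith, ← hn, Int.natAbs_neg]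
        rw [Int.abs_eq_natAbs] at *
        omega) (f := (f.translate (p / q)).swap) hcop rfl
      rw [eval_swap, eval_translate, hessian_swap, hessian_translate] at hw
      exact ⟨p / q :: w, hw⟩

lemma eval_one_zero : f.eval 1 0 = f.a := by simp [eval, quartic]

lemma hessian_one_zero : f.hessian 1 0 = f.b ^ 2 - f.a * f.c := by simp [hessian]

/-- Decides the absence of admissible points modulo `M`. -/
def isObstructed (f : BinaryQuartic) (M : ℕ) : Bool :=
  (List.range M).all fun p => (List.range M).all fun q =>
    !((f.eval p q - 1) % M == 0 &&
      (isSquareMod M (5 + 4 * sextic f.a f.b f.c f.d f.e p q) ||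
        isSquareMod M (5 - 4 * sextic f.a f.b f.c f.d f.e p q)))

lemma IsTame.of_isObstructed {M : ℕ} (hM : 0 < M) (h : f.isObstructed M = true) :
    f.IsTame := by
  rintro p q ⟨h1, Z, hZ⟩
  have := NeZero.of_pos hM
  exfalso
  simp only [isObstructed, List.all_eq_true, List.mem_range] at h
  have h := h _ (ZMod.val_lt (p : ZMod M)) _ (ZMod.val_lt (q : ZMod M))
  rw [Bool.not_eq_true', ← Bool.not_eq_true, Bool.and_eq_true, Bool.or_eq_true, beq_iff_eq,
    ← Int.dvd_iff_emod_eq_zero, ← ZMod.intCast_zmod_eq_zero_iff_dvd] at h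
  refine h ⟨?_, hZ.imp (fun hZ => QuarticRing.isSquareMod_of_eq (Z := Z) hM ?_)
    fun hZ => QuarticRing.isSquareMod_of_eq (Z := Z) hM ?_⟩
  · have := congrArg (Int.cast : ℤ → ZMod M) h1
    simp only [eval, quartic] at this ⊢
    push_cast at this ⊢
    simp only [ZMod.natCast_zmod_val]
    rw [this, sub_self]
  all_goals
    have := congrArg (Int.cast : ℤ → ZMod M) hZ
    simp only [sextic] at this ⊢
    push_cast at this ⊢
    simp only [ZMod.natCast_zmod_val]
    rw [this]

end BinaryQuartic

/-- Integer square root of `n` found bit by bit, starting from `r` and from the bit `s`. -/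
def sqrtBits (n : ℕ) : ℕ → ℕ → ℕ → ℕ
  | 0, _, r => r
  | k + 1, s, r =>
    bif Nat.ble ((r + s) * (r + s)) n then sqrtBits n k (s / 2) (r + s) else sqrtBits n k (s / 2) r

lemma sqrtBits_mul_self {t k r : ℕ} (h1 : r ≤ t) (h2 : t < r + 2 ^ (k + 1)) :
    sqrtBits (t * t) (k + 1) (2 ^ k) r = t := by
  have hble (x : ℕ) : Nat.ble (x * x) (t * t) = decide (x ≤ t) := by
    rw [Bool.eq_iff_iff, Nat.ble_eq, decide_eq_true_iff, Nat.mul_self_le_mul_self_iff]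
  induction k generalizing r with
  | zero =>
    simp only [sqrtBits, hble]
    by_cases h : r + 2 ^ 0 ≤ t <;>
      simp only [h, decide_true, decide_false, cond_true, cond_false] <;>
      omega
  | succ k ih =>
    rw [sqrtBits, hble, show 2 ^ (k + 1) / 2 = 2 ^ k by omega]
    rw [pow_succ] at h2
    by_cases h : r + 2 ^ (k + 1) ≤ t
    · rw [decide_eq_true h, cond_true]
      exact ih h (by omega)
    · rw [decide_eq_false h, cond_false]
      exact ih h1 (by omega)

/-- The only candidate for the absolute value of a square root of `R` below `2 ^ (k + 1)`. -/
def sqrtCandidate (k : ℕ) (R : ℤ) : ℤ := sqrtBits R.toNat (k + 1) (2 ^ k) 0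

lemma eq_sqrtCandidate {k : ℕ} {G R : ℤ} (h : G ^ 2 = R) (hR : R < (2 ^ (k + 1)) ^ 2) :
    G = sqrtCandidate k R ∨ G = -sqrtCandidate k R := by
  have : sqrtCandidate k R = G.natAbs := by
    rw [sqrtCandidate, show R.toNat = G.natAbs * G.natAbs by
      zify; simp [← h, sq, mul_self_nonneg]]
    rw [sqrtBits_mul_self (Nat.zero_le _)]
    zify
    rw [zero_add]
    exact abs_lt_of_sq_lt_sq (h ▸ hR) (by positivity)
  omega

namespace BinaryQuartic

/-- `f` is obstructed modulo an element of `Ms`, or carried by a word of `ws` to `L`. -/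
def isResolved (Ms : List ℕ) (ws : List (List ℤ)) (L : List BinaryQuartic) (f : BinaryQuartic) :
    Bool :=
  Ms.any (fun M => f.isObstructed M) ||
    ws.any fun w => L.any fun s => f.act w = s || (f.act w).reflect = s

lemma IsTame.of_isResolved {Ms : List ℕ} {ws : List (List ℤ)} {L : List BinaryQuartic}
    {f : BinaryQuartic} (hMs : ∀ M ∈ Ms, 0 < M) (hL : ∀ s ∈ L, s.IsTame)
    (h : f.isResolved Ms ws L = true) : f.IsTame := by
  simp only [isResolved, Bool.or_eq_true, List.any_eq_true, decide_eq_true_eq] at h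
  obtain ⟨M, hM, h⟩ | ⟨w, -, s, hs, h | h⟩ := h
  · exact .of_isObstructed (hMs M hM) h
  · exact .of_act (w := w) (h ▸ hL s hs)
  · exact .of_act (w := w) (.of_reflect (h ▸ hL s hs))

/-- If `f` has invariants `4` and `γ`, then `f` satisfies the test `P`. -/
def testForm (γ : ℤ) (P : BinaryQuartic → Bool) (f : BinaryQuartic) : Bool :=
  f.g₂ != 4 || f.g₃ != γ || P f

/-- The form with leading coefficients `a, b, c`, invariant `4` and leading coefficient `G` of the
sextic covariant. -/
def ofSextic (a b c G : ℤ) : BinaryQuartic :=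
  let d := (G + 3 * a * b * c - 2 * (b * b * b)) / (a * a)
  ⟨a, b, c, d, (4 + 4 * b * d - 3 * (c * c)) / a⟩

/-- Test all forms with leading coefficients `a, b, c`, where `a ≠ 0`. -/
def testOfLeading (γ : ℤ) (P : BinaryQuartic → Bool) (a b c : ℤ) : Bool :=
  let H := b * b - a * c
  let R := 4 * (H * H * H) - 4 * (a * a) * H - γ * (a * a * a)
  let s := sqrtCandidate 10 R
  s * s != R || testForm γ P (ofSextic a b c s) && testForm γ P (ofSextic a b c (-s))

/-- Test all forms with leading coefficients `0, b, c`. -/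
def testOfZero (γ : ℤ) (P : BinaryQuartic → Bool) (b c : ℤ) : Bool :=
  let d := (3 * c ^ 2 - 4) / (4 * b)
  testForm γ P ⟨0, b, c, d, (2 * b * c * d - c ^ 3 - γ) / b ^ 2⟩

lemma of_testForm {γ : ℤ} {P : BinaryQuartic → Bool} {f : BinaryQuartic} (h2 : f.g₂ = 4)
    (h3 : f.g₃ = γ) (h : testForm γ P f = true) : P f = true := by
  simpa [testForm, h2, h3] using h

lemma of_testOfLeading {γ : ℤ} {P : BinaryQuartic → Bool} {f : BinaryQuartic} (h2 : f.g₂ = 4)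
    (h3 : f.g₃ = γ) (ha : f.a ≠ 0)
    (hR : 4 * (f.b ^ 2 - f.a * f.c) ^ 3 - 4 * f.a ^ 2 * (f.b ^ 2 - f.a * f.c) -
      γ * f.a ^ 3 < (2 ^ 11) ^ 2)
    (h : testOfLeading γ P f.a f.b f.c = true) : P f = true := by
  obtain ⟨a, b, c, d, e⟩ := f
  simp only [g₂, g₃] at h2 h3 ha h hR
  have hG : (a ^ 2 * d - 3 * a * b * c + 2 * b ^ 3) ^ 2 =
      4 * (b ^ 2 - a * c) ^ 3 - 4 * a ^ 2 * (b ^ 2 - a * c) - γ * a ^ 3 := by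
    rw [← h3]
    linear_combination (-a ^ 2 * (b ^ 2 - a * c)) * h2
  have hof : ofSextic a b c (a ^ 2 * d - 3 * a * b * c + 2 * b ^ 3) = ⟨a, b, c, d, e⟩ := by
    have hd : (a ^ 2 * d - 3 * a * b * c + 2 * b ^ 3 + 3 * a * b * c - 2 * (b * b * b)) / (a * a) =
        d := Int.ediv_eq_of_eq_mul_right (mul_ne_zero ha ha) (by ring)
    have he : (4 + 4 * b * d - 3 * (c * c)) / a = e :=
      Int.ediv_eq_of_eq_mul_right ha (by linarith)
    simp only [ofSextic, hd, he]
  simp only [testOfLeading, Bool.or_eq_true, Bool.and_eq_true, bne_iff_ne] at h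
  rw [show 4 * ((b * b - a * c) * (b * b - a * c) * (b * b - a * c)) - 4 * (a * a) * (b * b - a * c)
    - γ * (a * a * a) = 4 * (b ^ 2 - a * c) ^ 3 - 4 * a ^ 2 * (b ^ 2 - a * c) - γ * a ^ 3 by ring]
    at h
  have hs := eq_sqrtCandidate (k := 10) hG hR
  replace h := h.resolve_left (not_not_intro (Eq.trans (by
    rcases hs with h | h <;> rw [h] <;> ring) hG))
  refine of_testForm (γ := γ) h2 h3 ?_
  rcases eq_sqrtCandidate (k := 10) hG hR with h' | h'
  · rw [← hof, h']; exact h.1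
  · rw [← hof, h']; exact h.2

lemma of_testOfZero {γ : ℤ} {P : BinaryQuartic → Bool} {f : BinaryQuartic} (h2 : f.g₂ = 4)
    (h3 : f.g₃ = γ) (ha : f.a = 0) (hb : f.b ≠ 0) (h : testOfZero γ P f.b f.c = true) :
    P f = true := by
  obtain ⟨a, b, c, d, e⟩ := f
  simp only [g₂, g₃] at h2 h3 ha hb h
  subst ha
  have hd : (3 * c ^ 2 - 4) / (4 * b) = d :=
    Int.ediv_eq_of_eq_mul_right (by simpa using hb) (by linarith)
  have he : (2 * b * c * d - c ^ 3 - γ) / b ^ 2 = e :=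
    Int.ediv_eq_of_eq_mul_right (pow_ne_zero 2 hb) (by linarith)
  simp only [testOfZero, hd, he] at h
  exact of_testForm h2 h3 h

/-- Test all forms with bounded reduced leading coefficients. -/
def testAll (γ : ℤ) (P : BinaryQuartic → Bool) : Bool :=
  ((List.range 22).all fun i => (List.range 12).all fun j =>
    Nat.blt (i + 1) (2 * j) ||
      let n := (64 + j * j) / (i + 1)
      (List.range (2 * n + 1)).all fun k =>
        testOfLeading γ P (i + 1) j (k - n) && testOfLeading γ P (-(i + 1)) j (k - n)) &&
    (List.range 9).all fun j => (List.range (2 * j + 1)).all fun k => testOfZero γ P j (k - j)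

/-- A form with small value and Hessian at `(1, 0)` is tame if reduced such forms are. -/
lemma IsTame.of_testAll {γ : ℤ} {P : BinaryQuartic → Bool} {f : BinaryQuartic}
    (hP : ∀ f, P f = true → f.IsTame) (h : testAll γ P = true) (hγ : |γ| ≤ 100) (h2 : f.g₂ = 4)
    (h3 : f.g₃ = γ) (ha : |f.a| ≤ 22) (hH : |f.b ^ 2 - f.a * f.c| ≤ 64) : f.IsTame := by
  simp only [testAll, Bool.and_eq_true, List.all_eq_true, List.mem_range, Bool.or_eq_true,
    Nat.blt_eq] at h
  obtain ⟨hne, hz⟩ := h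
  rw [abs_le] at hγ ha hH
  rcases eq_or_ne f.a 0 with ha0 | ha0
  · have hb0 : f.b ≠ 0 := by
      intro hb
      simp only [g₂, ha0, hb] at h2
      omega
    wlog hb : 0 < f.b generalizing f
    · refine .of_reflect (this (f := f.reflect) ?_ ?_ ha ?_ ha0 ?_ ?_)
      · rw [g₂_reflect, h2]
      · rw [g₃_reflect, h3]
      · simpa [reflect] using hH
      · simpa [reflect] using hb0
      · simp only [reflect]; omega
    have hb8 : f.b ≤ 8 := by rw [ha0] at hH; nlinarith
    set k := -((f.c + f.b) / (2 * f.b)) with hk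
    have hc := Int.emod_add_mul_ediv (f.c + f.b) (2 * f.b)
    have hc1 := Int.emod_nonneg (f.c + f.b) (b := 2 * f.b) (by omega)
    have hc2 := Int.emod_lt_of_pos (f.c + f.b) (b := 2 * f.b) (by omega)
    have hcc : (f.translate k).c = (f.c + f.b) % (2 * f.b) - f.b := by
      simp only [translate, ha0, hk]; linear_combination -hc
    have hbb : (f.translate k).b = f.b := by simp [translate, ha0]
    refine .of_translate (k := k) (hP _ (of_testOfZero (γ := γ) ?_ ?_ ha0 (by rwa [hbb]) ?_))
    · rw [g₂_translate, h2]
    · rw [g₃_translate, h3]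
    have := hz f.b.toNat (by omega) ((f.translate k).c + f.b).toNat (by omega)
    rwa [Int.toNat_of_nonneg hb.le, Int.toNat_of_nonneg (by omega), add_sub_cancel_right,
      ← hbb] at this
  · wlog hb : |2 * f.b| ≤ |f.a| generalizing f
    · obtain ⟨k, hk⟩ : ∃ k, |2 * (f.b + f.a * k)| ≤ |f.a| := by
        refine ⟨-((2 * f.b + |f.a|) / (2 * f.a)), ?_⟩
        have h1 := Int.emod_add_mul_ediv (2 * f.b + |f.a|) (2 * f.a)
        have h2 := Int.emod_nonneg (2 * f.b + |f.a|) (b := 2 * f.a) (by omega)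
        have h3 := Int.emod_lt_abs (2 * f.b + |f.a|) (b := 2 * f.a) (by omega)
        rw [abs_mul, abs_two] at h3
        rw [abs_le]
        constructor <;> linarith
      refine .of_translate (k := k) (this (f := f.translate k) ?_ ?_ ha ?_ ha0 hk)
      · rw [g₂_translate, h2]
      · rw [g₃_translate, h3]
      · rw [show (f.translate k).b ^ 2 - (f.translate k).a * (f.translate k).c =
            f.b ^ 2 - f.a * f.c by simp only [translate]; ring]
        exact hH
    wlog hb0 : 0 ≤ f.b generalizing f
    · refine .of_reflect (this (f := f.reflect) ?_ ?_ ha ?_ ha0 ?_ ?_)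
      · rw [g₂_reflect, h2]
      · rw [g₃_reflect, h3]
      · simpa [reflect] using hH
      · simpa [reflect] using hb
      · simp only [reflect]; omega
    rw [Int.abs_eq_natAbs, Int.abs_eq_natAbs] at hb
    have hlead := (hne (f.a.natAbs - 1) (by omega) f.b.toNat (by omega)).resolve_left (by omega)
    rw [Nat.sub_add_cancel (by omega)] at hlead
    set n := (64 + f.b.toNat * f.b.toNat) / f.a.natAbs with hn
    have hc : f.c.natAbs ≤ n := by
      rw [hn, Nat.le_div_iff_mul_le (by omega), mul_comm, ← Int.natAbs_mul]
      zify
      rw [Int.toNat_of_nonneg hb0, abs_le]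
      constructor <;> nlinarith
    have := hlead (f.c + n).toNat (by omega)
    have hcast : ((f.a.natAbs - 1 : ℕ) : ℤ) + 1 = |f.a| := by rw [Int.abs_eq_natAbs]; omega
    rw [Int.toNat_of_nonneg hb0, Int.toNat_of_nonneg (by omega), add_sub_cancel_right,
      hcast] at this
    refine hP _ (of_testOfLeading h2 h3 ha0 ?_ ?_)
    rotate_left
    · rcases abs_choice f.a with h | h <;> rw [h] at this
      · exact this.1
      · simpa using this.2
    generalize f.b ^ 2 - f.a * f.c = H at hH
    have hH' := abs_le.2 hH
    have ha' := abs_le.2 ha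
    have hγ' := abs_le.2 hγ
    calc _ ≤ |4 * H ^ 3 - 4 * f.a ^ 2 * H - γ * f.a ^ 3| := le_abs_self _
      _ ≤ |4 * H ^ 3| + |4 * f.a ^ 2 * H| + |γ * f.a ^ 3| :=
        (abs_sub _ _).trans (add_le_add_left (abs_sub _ _) _)
      _ = 4 * |H| ^ 3 + 4 * |f.a| ^ 2 * |H| + |γ| * |f.a| ^ 3 := by
        simp only [abs_mul, abs_pow]; rfl
      _ ≤ 4 * 64 ^ 3 + 4 * 22 ^ 2 * 64 + 100 * 22 ^ 3 := by gcongr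
      _ < (2 ^ 11) ^ 2 := by norm_num

end BinaryQuartic

namespace BinaryQuartic

/-- A form is tame if its admissible points are `±s` for `s` in a list of points which have small
Hessian or are not admissible modulo `M`. -/
lemma IsTame.of_forall_exists {f : BinaryQuartic} (M : ℕ) (hM : 0 < M) {L : List (ℤ × ℤ)}
    (hL : L.all (fun s => decide (f.hessian s.1 s.2 < 1000) ||
      !(isSquareMod M (5 + 4 * sextic f.a f.b f.c f.d f.e s.1 s.2) ||
        isSquareMod M (5 - 4 * sextic f.a f.b f.c f.d f.e s.1 s.2))) = true)
    (h : ∀ {p q Z : ℤ}, quartic f.a f.b f.c f.d f.e p q = 1 →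
      (Z ^ 2 = 5 + 4 * sextic f.a f.b f.c f.d f.e p q ∨
        Z ^ 2 = 5 - 4 * sextic f.a f.b f.c f.d f.e p q) →
      ∃ s ∈ L, (p = s.1 ∧ q = s.2) ∨ (p = -s.1 ∧ q = -s.2)) : f.IsTame := by
  rintro p q ⟨h1, Z, hZ⟩
  simp only [List.all_eq_true, Bool.or_eq_true, decide_eq_true_eq] at hL
  obtain ⟨s, hs, hpq⟩ := h h1 hZ
  have hsex : sextic f.a f.b f.c f.d f.e p q = sextic f.a f.b f.c f.d f.e s.1 s.2 := by
    obtain ⟨rfl, rfl⟩ | ⟨rfl, rfl⟩ := hpq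
    · rfl
    · simp only [sextic]; ring
  have hhess : f.hessian p q = f.hessian s.1 s.2 := by
    obtain ⟨rfl, rfl⟩ | ⟨rfl, rfl⟩ := hpq
    · rfl
    · simp only [hessian]; ring
  rw [hhess]
  refine (hL s hs).resolve_right fun hns => ?_
  rw [Bool.not_eq_true', ← Bool.not_eq_true, Bool.or_eq_true] at hns
  rw [hsex] at hZ
  exact hns (hZ.imp (fun h => QuarticRing.isSquareMod_of_eq (Z := Z) hM (by rw [← h, Int.cast_pow]))
    fun h => QuarticRing.isSquareMod_of_eq (Z := Z) hM (by rw [← h, Int.cast_pow]))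

lemma isTame_0_1_0_neg1_1 : IsTame ⟨0, 1, 0, -1, 1⟩ := by
  rintro p q ⟨h, -⟩
  simp only [eval, quartic] at h
  have hq : q = 1 ∨ q = -1 :=
    Int.isUnit_iff.1 (.of_mul_eq_one (4 * p ^ 3 - 4 * p * q ^ 2 + q ^ 3) (by linarith))
  have hp : p * (p - 1) * (p + 1) = 0 := by rcases hq with rfl | rfl <;> linarith
  obtain (rfl | hp) | hp : (p = 0 ∨ p - 1 = 0) ∨ p + 1 = 0 := by simpa using hp
  · rcases hq with rfl | rfl <;> norm_num [hessian]
  · obtain rfl : p = 1 := by linarith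
    rcases hq with rfl | rfl <;> norm_num [hessian]
  · obtain rfl : p = -1 := by linarith
    rcases hq with rfl | rfl <;> norm_num [hessian]

lemma isTame_0_1_0_neg1_neg23 : IsTame ⟨0, 1, 0, -1, -23⟩ := by
  rintro p q ⟨h, -⟩
  simp only [eval, quartic] at h
  have hq : q = 1 ∨ q = -1 :=
    Int.isUnit_iff.1 (.of_mul_eq_one (4 * p ^ 3 - 4 * p * q ^ 2 - 23 * q ^ 3) (by linarith))
  rcases hq with rfl | rfl
  · have hp : (p - 2) * (p ^ 2 + 2 * p + 3) = 0 := by linarith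
    obtain hp | hp := mul_eq_zero.1 hp
    · obtain rfl : p = 2 := by linarith
      norm_num [hessian]
    · nlinarith [sq_nonneg (p + 1)]
  · have hp : (p + 2) * (p ^ 2 - 2 * p + 3) = 0 := by linarith
    obtain hp | hp := mul_eq_zero.1 hp
    · obtain rfl : p = -2 := by linarith
      norm_num [hessian]
    · nlinarith [sq_nonneg (p - 1)]

lemma isTame_1_1_1_0_1 : IsTame ⟨1, 1, 1, 0, 1⟩ := by
  rintro p q ⟨h, -⟩
  simp only [eval, quartic] at h
  have h' : (p * (p + 2 * q)) ^ 2 + 2 * (p * q) ^ 2 + (q ^ 2) ^ 2 = 1 := by linarith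
  have hpq : (p * q) ^ 2 < 1 := by nlinarith [sq_nonneg (p * (p + 2 * q)), sq_nonneg (q ^ 2)]
  obtain rfl | rfl : p = 0 ∨ q = 0 := by
    rw [← mul_eq_zero, ← sq_eq_zero_iff]
    linarith [sq_nonneg (p * q), Int.lt_add_one_iff.1 (hpq.trans_eq (zero_add 1).symm)]
  · have : hessian ⟨1, 1, 1, 0, 1⟩ 0 q = -q ^ 4 := by simp [hessian]; try ring
    nlinarith
  · have : hessian ⟨1, 1, 1, 0, 1⟩ p 0 = 0 := by simp [hessian]; try ring
    linarith

lemma isTame_of_g₃_eq_neg_forty_nine {f : BinaryQuartic} (h2 : f.g₂ = 4) (h3 : f.g₃ = -49)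
    (ha : |f.a| ≤ 22) (hH : |f.b ^ 2 - f.a * f.c| ≤ 64) : f.IsTame := by
  refine .of_testAll (P := isResolved [5, 7]
    [[], [-1, -1], [1], [2, 0], [-2, 0], [-4, 0, -3, -1], [3, 0, 4, 1], [0]]
    [⟨1, 0, 2, 5, -8⟩, ⟨1, -2, 0, -1, 12⟩])
    (fun f => .of_isResolved (by decide) ?_) (by decide +kernel) (by norm_num) h2 h3 ha hH
  simp only [List.forall_mem_cons, List.not_mem_nil, false_imp_iff, implies_true, and_true]
  exact ⟨.of_forall_exists 25 (by norm_num) (by decide +kernel) quartic_1_0_2_5_neg8_eq_one,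
    .of_forall_exists 25 (by norm_num) (by decide +kernel) quartic_1_neg2_0_neg1_12_eq_one⟩

lemma isTame_of_g₃_eq_neg_twenty_five {f : BinaryQuartic} (h2 : f.g₂ = 4) (h3 : f.g₃ = -25)
    (ha : |f.a| ≤ 22) (hH : |f.b ^ 2 - f.a * f.c| ≤ 64) : f.IsTame := by
  refine .of_testAll (P := isResolved [5, 13]
    [[0], [], [4, -1, -1], [-4, 1, 1], [0, 1], [1, 1], [0, -1], [1, 0], [-1, 0], [4, -1, -2],
      [-4, 1, 2], [-1], [1], [-1, -1]]
    [⟨1, 5, 1, 0, 1⟩, ⟨1, 0, 2, 1, -8⟩, ⟨1, 5, -1, 0, 1⟩, ⟨1, -1, -2, -3, 4⟩, ⟨1, 0, 0, -5, 4⟩])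
    (fun f => .of_isResolved (by decide) ?_) (by decide +kernel) (by norm_num) h2 h3 ha hH
  simp only [List.forall_mem_cons, List.not_mem_nil, false_imp_iff, implies_true, and_true]
  exact ⟨.of_forall_exists 25 (by norm_num) (by decide +kernel) quartic_1_5_1_0_1_eq_one,
    .of_forall_exists 25 (by norm_num) (by decide +kernel) quartic_1_0_2_1_neg8_eq_one,
    .of_forall_exists 25 (by norm_num) (by decide +kernel) quartic_1_5_neg1_0_1_eq_one,
    .of_forall_exists 25 (by norm_num) (by decide +kernel) quartic_1_neg1_neg2_neg3_4_eq_one,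
    .of_forall_exists 25 (by norm_num) (by decide +kernel) quartic_1_0_0_neg5_4_eq_one⟩

lemma isTame_of_g₃_eq_neg_one {f : BinaryQuartic} (h2 : f.g₂ = 4) (h3 : f.g₃ = -1)
    (ha : |f.a| ≤ 22) (hH : |f.b ^ 2 - f.a * f.c| ≤ 64) : f.IsTame := by
  refine .of_testAll (P := isResolved []
    [[0], [0, 3], [0, -2], [], [-1, 0], [1, 0], [1], [-1], [-1, 1], [1, -1], [-3, -1], [3, 1],
      [-1, -1], [-1, -2, -1], [0, 1]]
    [⟨0, 1, 0, -1, 1⟩, ⟨1, 1, 1, 0, 1⟩])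
    (fun f => .of_isResolved (by decide) ?_) (by decide +kernel) (by norm_num) h2 h3 ha hH
  simp only [List.forall_mem_cons, List.not_mem_nil, false_imp_iff, implies_true, and_true]
  exact ⟨isTame_0_1_0_neg1_1, isTame_1_1_1_0_1⟩

lemma isTame_of_g₃_eq_twenty_three {f : BinaryQuartic} (h2 : f.g₂ = 4) (h3 : f.g₃ = 23)
    (ha : |f.a| ≤ 22) (hH : |f.b ^ 2 - f.a * f.c| ≤ 64) : f.IsTame := by
  refine .of_testAll (P := isResolved []
    [[], [1, 1], [0]]
    [⟨1, 0, -2, 1, -8⟩, ⟨0, 1, 0, -1, -23⟩])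
    (fun f => .of_isResolved (by decide) ?_) (by decide +kernel) (by norm_num) h2 h3 ha hH
  simp only [List.forall_mem_cons, List.not_mem_nil, false_imp_iff, implies_true, and_true]
  exact ⟨.of_forall_exists 25 (by norm_num) (by decide +kernel) quartic_1_0_neg2_1_neg8_eq_one,
    isTame_0_1_0_neg1_neg23⟩

lemma isTame_of_g₃_eq_seventy_one {f : BinaryQuartic} (h2 : f.g₂ = 4) (h3 : f.g₃ = 71)
    (ha : |f.a| ≤ 22) (hH : |f.b ^ 2 - f.a * f.c| ≤ 64) : f.IsTame := by
  refine .of_testAll (P := isResolved [5]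
    [[0], [1, 1], [-1, 0], [1, 0], [-3, 0], [3, 0]]
    [⟨1, 3, 0, -1, -8⟩, ⟨1, 1, -3, 2, -15⟩, ⟨1, 1, -2, -3, -20⟩])
    (fun f => .of_isResolved (by decide) ?_) (by decide +kernel) (by norm_num) h2 h3 ha hH
  simp only [List.forall_mem_cons, List.not_mem_nil, false_imp_iff, implies_true, and_true]
  exact ⟨.of_forall_exists 25 (by norm_num) (by decide +kernel) quartic_1_3_0_neg1_neg8_eq_one,
    .of_forall_exists 25 (by norm_num) (by decide +kernel) quartic_1_1_neg3_2_neg15_eq_one,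
    .of_forall_exists 25 (by norm_num) (by decide +kernel) quartic_1_1_neg2_neg3_neg20_eq_one⟩

end BinaryQuartic

namespace BinaryQuartic

/-- The form with invariants `4` and `4N³ - 4N - X²` representing `1` with Hessian `N`. -/
def ofPoint (N X : ℤ) : BinaryQuartic := ⟨1, 0, -N, X, 4 - 3 * N ^ 2⟩

/-- The value and the Hessian of `ofPoint N X` near the root `√N`, in bounded quantities. -/
lemma abs_lt_of_approx {r ε δ u q : ℝ} (hr : 31 ≤ r) (hε : |ε| * r ^ 2 ≤ 18.2)
    (hδ : |δ| * r ≤ 1.03) (hq : 0 ≤ q) (huq : |u| * q ≤ 1) (hur : |u| ^ 2 * r ≤ 3)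
    (hqr : q ^ 2 / r ≤ 1 / 3) :
    |u ^ 4 + 4 * r * u ^ 3 * q + 4 * δ * u * q ^ 3 + 4 * ε * q ^ 4| < 23 ∧
      |r ^ 2 * u ^ 4 - 2 * δ * u ^ 3 * q - (6 * ε - 2) * u ^ 2 * q ^ 2 - 8 * r * ε * u * q ^ 3
        + δ ^ 2 * q ^ 4| < 65 := by
  have hr0 : 0 < r := by linarith
  have hr1 : 1 / r ^ 2 ≤ 1 / 31 ^ 2 := by gcongr
  have hqa : |q| = q := abs_of_nonneg hq
  constructor
  · calc |u ^ 4 + 4 * r * u ^ 3 * q + 4 * δ * u * q ^ 3 + 4 * ε * q ^ 4|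
        ≤ |u ^ 4| + |4 * r * u ^ 3 * q| + |4 * δ * u * q ^ 3| + |4 * ε * q ^ 4| :=
          (abs_add_le _ _).trans (add_le_add_left (abs_add_three _ _ _) _)
      _ = (|u| ^ 2 * r) ^ 2 * (1 / r ^ 2) + 4 * (|u| ^ 2 * r) * (|u| * q)
          + 4 * (|δ| * r) * (|u| * q) * (q ^ 2 / r) + 4 * (|ε| * r ^ 2) * (q ^ 2 / r) ^ 2 := by
        simp only [abs_mul, abs_pow, hqa, abs_of_pos hr0, Nat.abs_ofNat]
        field_simp
      _ ≤ 3 ^ 2 * (1 / 31 ^ 2) + 4 * 3 * 1 + 4 * 1.03 * 1 * (1 / 3) + 4 * 18.2 * (1 / 3) ^ 2 := by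
        gcongr
      _ < 23 := by norm_num
  · calc |r ^ 2 * u ^ 4 - 2 * δ * u ^ 3 * q - (6 * ε - 2) * u ^ 2 * q ^ 2 - 8 * r * ε * u * q ^ 3
        + δ ^ 2 * q ^ 4|
        = |r ^ 2 * u ^ 4 + -(2 * δ * u ^ 3 * q) + -(6 * ε * u ^ 2 * q ^ 2) + 2 * u ^ 2 * q ^ 2
          + -(8 * r * ε * u * q ^ 3) + δ ^ 2 * q ^ 4| := by congr 1; ring
      _ ≤ |r ^ 2 * u ^ 4| + |2 * δ * u ^ 3 * q| + |6 * ε * u ^ 2 * q ^ 2| + |2 * u ^ 2 * q ^ 2|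
          + |8 * r * ε * u * q ^ 3| + |δ ^ 2 * q ^ 4| := by
        rw [← abs_neg (2 * δ * u ^ 3 * q), ← abs_neg (6 * ε * u ^ 2 * q ^ 2),
          ← abs_neg (8 * r * ε * u * q ^ 3)]
        refine (abs_add_le _ _).trans (add_le_add_left ((abs_add_le _ _).trans
          (add_le_add_left ((abs_add_le _ _).trans (add_le_add_left (abs_add_three _ _ _) _)) _)) _)
      _ = (|u| ^ 2 * r) ^ 2 + 2 * (|δ| * r) * (|u| ^ 2 * r) * (|u| * q) * (1 / r ^ 2)
          + 6 * (|ε| * r ^ 2) * (1 / r ^ 2) * (|u| * q) ^ 2 + 2 * (|u| * q) ^ 2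
          + 8 * (|ε| * r ^ 2) * (|u| * q) * (q ^ 2 / r) + (|δ| * r) ^ 2 * (q ^ 2 / r) ^ 2 := by
        simp only [abs_mul, abs_pow, hqa, abs_of_pos hr0, Nat.abs_ofNat]
        field_simp
      _ ≤ 3 ^ 2 + 2 * 1.03 * 3 * 1 * (1 / 31 ^ 2) + 6 * 18.2 * (1 / 31 ^ 2) * 1 ^ 2 + 2 * 1 ^ 2
          + 8 * 18.2 * 1 * (1 / 3) + 1.03 ^ 2 * (1 / 3) ^ 2 := by
        gcongr
      _ < 65 := by norm_num

/-- A form with large Hessian at `(1, 0)` has a primitive point where it and its Hessian are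
small. -/
lemma exists_isCoprime_abs_le {N X : ℤ} (hN : 1000 ≤ N) (hX : 0 < X)
    (h : |X ^ 2 - 4 * N ^ 3 + 4 * N| ≤ 71) :
    ∃ p q : ℤ, IsCoprime p q ∧ |(ofPoint N X).eval p q| ≤ 22 ∧
      |(ofPoint N X).hessian p q| ≤ 64 := by
  set r : ℝ := √N with hr
  have hNr : (1000 : ℝ) ≤ N := by exact_mod_cast hN
  have hXr : (0 : ℝ) < X := by exact_mod_cast hX
  have hr2 : r ^ 2 = N := Real.sq_sqrt (by linarith)
  have hr31 : 31 ≤ r := Real.le_sqrt_of_sq_le (by norm_num; linarith)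
  set c : ℝ := X ^ 2 - 4 * N ^ 3 + 4 * N with hc
  have hcabs : |c| ≤ 71 := by rw [hc]; exact_mod_cast h
  have hX2 : (X : ℝ) ^ 2 = 4 * r ^ 6 - 4 * r ^ 2 + c := by rw [hc, ← hr2]; ring
  have hXlow : 1.99 * r ^ 3 ≤ X := by
    refine le_of_sq_le_sq ?_ hXr.le
    have h1 : 961 ≤ r ^ 2 := by nlinarith
    have h2 : 961 ^ 2 * r ^ 2 ≤ (r ^ 2) ^ 2 * r ^ 2 := by gcongr
    nlinarith [neg_le_of_abs_le hcabs]
  set δ : ℝ := X - 2 * r ^ 3 with hδ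
  have hδc : δ * (X + 2 * r ^ 3) = c - 4 * r ^ 2 := by rw [hδ]; linear_combination hX2
  have hδr : |δ| * r ≤ 1.03 := by
    have h1 : |δ| * (3.99 * r ^ 3) ≤ |c - 4 * r ^ 2| := by
      rw [← hδc, abs_mul]
      exact mul_le_mul_of_nonneg_left ((by linarith : _ ≤ _).trans (le_abs_self _)) (abs_nonneg _)
    have h2 : |c - 4 * r ^ 2| ≤ 71 + 4 * r ^ 2 :=
      (abs_sub _ _).trans (add_le_add hcabs (abs_of_nonneg (by positivity)).le)
    have h3 : 961 ≤ r ^ 2 := by nlinarith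
    refine le_of_mul_le_mul_right (a := 3.99 * r ^ 2) ?_ (by positivity)
    linarith
  have hεr : |δ * r + 1| * r ^ 2 ≤ 18.2 := by
    have h1 : |δ * r + 1| * (3.99 * r ^ 3) ≤ |c * r + δ| := by
      rw [show c * r + δ = (δ * r + 1) * (X + 2 * r ^ 3) by linear_combination -r * hδc + hδ,
        abs_mul]
      exact mul_le_mul_of_nonneg_left ((by linarith : _ ≤ _).trans (le_abs_self _)) (abs_nonneg _)
    have h2 : |c * r + δ| ≤ 71 * r + |δ| := by
      refine (abs_add_le _ _).trans (add_le_add_left ?_ _)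
      rw [abs_mul, abs_of_pos (by linarith : 0 < r)]
      gcongr
    have h3 : |δ| ≤ r := by nlinarith [abs_nonneg δ]
    refine le_of_mul_le_mul_right (a := 3.99 * r) ?_ (by positivity)
    linarith
  set t := √(r / 3) with ht
  have ht2 : t ^ 2 = r / 3 := Real.sq_sqrt (by linarith)
  have ht1 : 1 ≤ t := Real.le_sqrt_of_sq_le (by linarith)
  obtain ⟨y, hy1, hy2⟩ := Real.exists_rat_abs_sub_le_and_den_le r (Nat.floor_pos.2 ht1)
  have hden : (0 : ℝ) < y.den := by exact_mod_cast y.pos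
  set u : ℝ := y.num - r * y.den with hu
  have hut : |u| * t ≤ 1 := by
    have h1 : |u| ≤ 1 / (⌊t⌋₊ + 1) := by
      have : u = -((r - y) * y.den) := by
        rw [hu, sub_mul, ← Rat.cast_natCast y.den, ← Rat.cast_mul, Rat.mul_den_eq_num]
        simp
      rw [this, abs_neg, abs_mul, abs_of_pos hden]
      refine (mul_le_mul_of_nonneg_right hy1 hden.le).trans_eq ?_
      field_simp
    calc |u| * t ≤ 1 / (⌊t⌋₊ + 1) * (⌊t⌋₊ + 1) := by
          gcongr
          exact (Nat.lt_floor_add_one t).le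
      _ = 1 := by field_simp
  have hdt : (y.den : ℝ) ≤ t := le_trans (by exact_mod_cast hy2) (Nat.floor_le (by linarith))
  have key := abs_lt_of_approx (u := u) (q := y.den) hr31 hεr hδr hden.le
    ((mul_le_mul_of_nonneg_left hdt (abs_nonneg _)).trans hut)
    (by nlinarith [mul_le_mul hut hut (by positivity) zero_le_one])
    (by rw [div_le_iff₀ (by linarith)]; nlinarith)
  refine ⟨y.num, y.den, ?_, ?_, ?_⟩
  · exact Int.isCoprime_iff_nat_coprime.2 (by simpa using y.reduced)
  · rw [← Int.lt_add_one_iff]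
    have : ((ofPoint N X).eval y.num y.den : ℝ) = u ^ 4 + 4 * r * u ^ 3 * y.den
        + 4 * δ * u * y.den ^ 3 + 4 * (δ * r + 1) * y.den ^ 4 := by
      simp only [eval, quartic, ofPoint]
      push_cast
      rw [hu, hδ, ← hr2]
      ring
    have := this ▸ key.1
    exact_mod_cast this
  · rw [← Int.lt_add_one_iff]
    have : ((ofPoint N X).hessian y.num y.den : ℝ) = r ^ 2 * u ^ 4 - 2 * δ * u ^ 3 * y.den
        - (6 * (δ * r + 1) - 2) * u ^ 2 * y.den ^ 2 - 8 * r * (δ * r + 1) * u * y.den ^ 3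
        + δ ^ 2 * y.den ^ 4 := by
      simp only [hessian, ofPoint]
      push_cast
      rw [hu, hδ, ← hr2]
      ring
    have := this ▸ key.2
    exact_mod_cast this

end BinaryQuartic

namespace BinaryQuartic

lemma isTame_ofPoint {N X d : ℤ} (hd1 : -2 ≤ d) (hd2 : d ≤ 3) (hd : d ≠ 2)
    (hN : 1000 ≤ N) (hX : 0 < X) (h : X ^ 2 = 4 * N ^ 3 - 4 * N + 1 - 24 * d) :
    (ofPoint N X).IsTame := by
  obtain ⟨p, q, hpq, h1, h2⟩ := exists_isCoprime_abs_le hN hX (by rw [h, abs_le]; omega)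
  obtain ⟨w, hw1, hw2⟩ := exists_act_eval_eq (f := ofPoint N X) hpq
  rw [← hw1, eval_one_zero] at h1
  rw [← hw2, hessian_one_zero] at h2
  have hg2 : ((ofPoint N X).act w).g₂ = 4 := by
    rw [g₂_act]; simp only [g₂, ofPoint]; ring
  have hg3 : ((ofPoint N X).act w).g₃ = 24 * d - 1 := by
    rw [g₃_act]; simp only [g₃, ofPoint]; linear_combination -h
  refine .of_act (w := w) ?_
  obtain rfl | rfl | rfl | rfl | rfl : d = -2 ∨ d = -1 ∨ d = 0 ∨ d = 1 ∨ d = 3 := by omega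
  · exact isTame_of_g₃_eq_neg_forty_nine hg2 hg3 h1 h2
  · exact isTame_of_g₃_eq_neg_twenty_five hg2 hg3 h1 h2
  · exact isTame_of_g₃_eq_neg_one hg2 hg3 h1 h2
  · exact isTame_of_g₃_eq_twenty_three hg2 hg3 h1 h2
  · exact isTame_of_g₃_eq_seventy_one hg2 hg3 h1 h2

end BinaryQuartic

lemma lt_of_sq_eq {N X Z d : ℤ} (hd1 : -3 ≤ d) (hd2 : d ≤ 3) (hX : 0 < X)
    (h : X ^ 2 = 4 * N ^ 3 - 4 * N + 1 - 24 * d) (hZ : Z ^ 2 = 5 + 4 * X) : N < 1000 := by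
  have mod_five : ∀ N X Z d : ZMod 5, X ^ 2 = 4 * N ^ 3 - 4 * N + 1 - 24 * d →
    Z ^ 2 = 5 + 4 * X → d ≠ 2 := by decide
  have hd : (d : ZMod 5) ≠ 2 :=
    mod_five N X Z d (by exact_mod_cast congrArg (Int.cast : ℤ → ZMod 5) h)
      (by exact_mod_cast congrArg (Int.cast : ℤ → ZMod 5) hZ)
  by_contra! hN
  have htame := BinaryQuartic.isTame_ofPoint (d := d)
    (by
      by_contra! hlt
      obtain rfl : d = -3 := by omega
      exact hd (by decide)) hd2 (by rintro rfl; exact hd rfl) hN hX h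
  have := htame 1 0 ⟨by simp [BinaryQuartic.eval_one_zero, BinaryQuartic.ofPoint], Z, .inl (by
    rw [hZ]; simp [sextic, BinaryQuartic.ofPoint])⟩
  simp [BinaryQuartic.hessian_one_zero, BinaryQuartic.ofPoint] at this
  omega

/-- All small solutions of `X² = 4N³ - 4N + 1 - 24d`, `Z² = 5 + 4X` are in a list. -/
def testSmall (L : List (ℤ × ℤ × ℤ)) : Bool :=
  (List.range 998).all fun i => (List.range 7).all fun j =>
    let N : ℤ := i + 2
    let d : ℤ := j - 3
    let R := 4 * (N * N * N) - 4 * N + 1 - 24 * d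
    let X := sqrtCandidate 15 R
    X * X != R ||
      let Z := sqrtCandidate 15 (5 + 4 * X)
      Z * Z != 5 + 4 * X || L.contains (d, N, Z)

lemma mem_of_testSmall {L : List (ℤ × ℤ × ℤ)} (hL : testSmall L = true) {N X Z d : ℤ}
    (hd1 : -3 ≤ d) (hd2 : d ≤ 3) (hX : 0 ≤ X) (hZ0 : 0 ≤ Z) (hN : 2 ≤ N) (hN' : N < 1000)
    (h : X ^ 2 = 4 * N ^ 3 - 4 * N + 1 - 24 * d) (hZ : Z ^ 2 = 5 + 4 * X) : (d, N, Z) ∈ L := by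
  simp only [testSmall, List.all_eq_true, List.mem_range] at hL
  have := hL (N - 2).toNat (by omega) (d + 3).toNat (by omega)
  rw [Int.toNat_of_nonneg (by omega), Int.toNat_of_nonneg (by omega), sub_add_cancel,
    add_sub_cancel_right] at this
  have hR : 4 * (N * N * N) - 4 * N + 1 - 24 * d = X ^ 2 := by rw [h]; ring
  have hXlt : X ^ 2 < (2 ^ 16) ^ 2 := by
    have : N ^ 3 ≤ 999 ^ 3 := by gcongr; omega
    linarith
  have hXs : sqrtCandidate 15 (X ^ 2) = X := by
    have := eq_sqrtCandidate (k := 15) rfl hXlt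
    have : 0 ≤ sqrtCandidate 15 (X ^ 2) := Int.natCast_nonneg _
    omega
  have hX' : X < 2 ^ 16 := lt_of_pow_lt_pow_left₀ 2 (by norm_num) hXlt
  have hZs : sqrtCandidate 15 (Z ^ 2) = Z := by
    have := eq_sqrtCandidate (k := 15) (G := Z) rfl (by rw [hZ]; norm_num; omega)
    have : 0 ≤ sqrtCandidate 15 (Z ^ 2) := Int.natCast_nonneg _
    omega
  rw [hR, hXs, ← hZ, hZs] at this
  simpa [← sq] using this

theorem binomial_eq_3_4 (d : ℤ) (hd1 : -3 ≤ d) (hd2 : d ≤ 3)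
    (n m : ℕ) (hn : 3 ≤ n) (hm : 4 ≤ m) :
    (n.choose 3 : ℤ) = (m.choose 4 : ℤ) + d ↔
      (d = 3 ∧ n = 4 ∧ m = 4) ∨
      (d = 0 ∧ n = 3 ∧ m = 4) ∨
      (d = 0 ∧ n = 7 ∧ m = 7) ∨
      (d = -1 ∧ n = 4 ∧ m = 5) ∨
      (d = -1 ∧ n = 34 ∧ m = 21) := by
  constructor
  · intro h
    have hn3 : (n.choose 3 : ℤ) * 6 = n * (n - 1) * (n - 2) := by
      have := Nat.descFactorial_eq_factorial_mul_choose n 3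
      obtain ⟨n, rfl⟩ := Nat.exists_eq_add_of_le' hn
      simp only [Nat.descFactorial, Nat.factorial] at this
      zify at this
      push_cast [show n + 3 - 2 = n + 1 by omega, show n + 3 - 1 = n + 2 by omega] at this ⊢
      linarith
    have hm4 : (m.choose 4 : ℤ) * 24 = m * (m - 1) * (m - 2) * (m - 3) := by
      have := Nat.descFactorial_eq_factorial_mul_choose m 4
      obtain ⟨m, rfl⟩ := Nat.exists_eq_add_of_le' hm
      simp only [Nat.descFactorial, Nat.factorial] at this
      zify at this
      push_cast [show m + 4 - 2 = m + 2 by omega, show m + 4 - 1 = m + 3 by omega,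
        show m + 4 - 3 = m + 1 by omega] at this ⊢
      linarith
    have hm' : (4 : ℤ) ≤ m := by exact_mod_cast hm
    have hX : 0 < (m : ℤ) ^ 2 - 3 * m + 1 := by nlinarith
    have heq : ((m : ℤ) ^ 2 - 3 * m + 1) ^ 2 =
        4 * ((n : ℤ) - 1) ^ 3 - 4 * ((n : ℤ) - 1) + 1 - 24 * d := by
      linear_combination -24 * h + 4 * hn3 - hm4
    have hZ : (2 * (m : ℤ) - 3) ^ 2 = 5 + 4 * ((m : ℤ) ^ 2 - 3 * m + 1) := by ring
    have hmem := mem_of_testSmall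
      (L := [(1, 2, 3), (3, 3, 5), (0, 2, 5), (0, 6, 11), (-1, 3, 7), (-1, 33, 39)])
      (by decide +kernel) hd1 hd2 hX.le (by omega) (by omega) (lt_of_sq_eq hd1 hd2 hX heq hZ) heq hZ
    simp only [List.mem_cons, Prod.mk.injEq, List.not_mem_nil, or_false] at hmem
    clear h hn3 hm4 hX heq hZ
    rcases hmem with h | h | h | h | h | h <;> omega
  · rintro (⟨rfl, rfl, rfl⟩ | ⟨rfl, rfl, rfl⟩ |
      ⟨rfl, rfl, rfl⟩ | ⟨rfl, rfl, rfl⟩ | ⟨rfl, rfl, rfl⟩) <;>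
      decide
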